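/- arXiv:1401.0705 — 4 statements merged into one kernel-verified Lean document; each statement's English description precedes it below -/
import Mathlib

section
/- There is no algorithm (no total computable function, for any fixed effective encoding of instances by natural numbers) that, given a 2-dimensional affine graph-directed iterated function system in which every vertex has at least one outgoing edge and every map has the form f_e(x) = D_e x + v_e with v_e a rational vector and D_e a diagonal matrix whose diagonal entries are negative powers of two (i.e., of the form 2^{−m} with m ≥ 1), together with a distinguished vertex q, decides whether the attractor component X_q has empty interior in ℝ². -/
/-- An edge of a 2-dimensional GIFS with diagonal linear parts, vertices encoded as
natural numbers: (source, target, exponents `m i` of the diagonal entries `2^{-m i}`,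
rational translation vector). -/
abbrev DiagEdge : Type := ℕ × ℕ × (Fin 2 → ℕ) × (Fin 2 → ℚ)

/-- The affine map `x ↦ D x + v` on `ℝ²` where `D = diag(2^{-m 0}, 2^{-m 1})`. -/
noncomputable def diagEdgeMap (m : Fin 2 → ℕ) (v : Fin 2 → ℚ) :
    EuclideanSpace ℝ (Fin 2) → EuclideanSpace ℝ (Fin 2) :=
  fun x => (WithLp.equiv 2 (Fin 2 → ℝ)).symm fun i =>
    x i / (2 : ℝ) ^ (m i) + (v i : ℝ)

/-- Well-formed instance with `k` vertices `0,…,k-1`, edge list `L` and distinguished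
vertex `q`: all diagonal entries are `2^{-m}` with `m ≥ 1` (so every map is contracting),
and every vertex has at least one outgoing edge. -/
def DiagGifsWF (k : ℕ) (L : List DiagEdge) (q : ℕ) : Prop :=
  q < k ∧
  (∀ e ∈ L, e.1 < k ∧ e.2.1 < k ∧ ∀ i : Fin 2, 1 ≤ e.2.2.1 i) ∧
  (∀ p < k, ∃ e ∈ L, e.1 = p)

/-- `X` is the family of attractors of the GIFS: nonempty compact sets indexed by the
vertices `p < k` satisfying the graph-directed fixed-point equations. -/
def IsDiagGifsAttractor (k : ℕ) (L : List DiagEdge)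
    (X : ℕ → Set (EuclideanSpace ℝ (Fin 2))) : Prop :=
  (∀ p < k, (X p).Nonempty ∧ IsCompact (X p)) ∧
  (∀ p < k, X p = ⋃ e ∈ L, ⋃ (_ : e.1 = p), diagEdgeMap e.2.2.1 e.2.2.2 '' X e.2.1)

namespace DiagGifs

/-- The alphabet data of the two-tape automaton: an end marker, the letters `Z, Y, W, E, B`
with special roles, the halting letters, and a local update rule. -/
structure Rules (A : Type) where
  (hash Z Y W E B : A)
  H : A → Prop
  F : A → A → A → A
  Z_ne_hash : Z ≠ hash
  Y_ne_hash : Y ≠ hash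
  E_ne_hash : E ≠ hash
  B_ne_hash : B ≠ hash
  Z_ne_Y : Z ≠ Y
  Z_ne_E : Z ≠ E
  Y_ne_E : Y ≠ E
  B_ne_W : B ≠ W
  W_ne_E : W ≠ E
  not_H_W : ¬ H W

/-- The states of the automaton. -/
inductive St
  | s0 | scan | sink | lt | cb | gt | cc | va | mid | p1 | p2 | p3 | zs
  | chain (i : ℕ)

variable {A : Type}

/-- Pairs of consecutive letters which must not occur in a good token. -/
def Rules.Bad (T : Rules A) (x y : A) : Prop :=
  (y = T.E ∧ ¬ T.H x ∧ x ≠ T.E) ∨ (x = T.E ∧ y ≠ T.E ∧ y ≠ T.hash) ∨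
    (y = T.hash ∧ x ≠ T.E) ∨ (x = T.Z ∧ y ≠ T.Z ∧ y ≠ T.Y)

/-- `Step T w x y p r k l`: the automaton may move from state `p` to state `r`, consuming `k`
letters of the first tape, which starts with `x`, and `l` letters of the second one, which
starts with `y`. -/
inductive Step (T : Rules A) (w : List A) (x y : ℕ → A) : St → St → ℕ → ℕ → Prop
  | s0_sink (hZ : x 0 ≠ T.Z) (hx : x 0 ≠ T.hash) (hy : y 0 ≠ T.hash) : Step T w x y .s0 .sink 1 1
  | s0_end (hx : x 0 = T.hash) (hy : y 0 = T.hash) : Step T w x y .s0 .s0 1 1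
  | lt_two {p} (hp : p = .s0 ∨ p = .lt) (hx : x 0 ≠ T.hash) (hy : y 0 ≠ T.hash)
      (hy' : y 1 ≠ T.hash) : Step T w x y p .lt 1 2
  | lt_one (hx : x 0 ≠ T.hash) (hy : y 0 ≠ T.hash) : Step T w x y .lt .lt 1 1
  | lt_end_two {p} (hp : p = .s0 ∨ p = .lt) (hx : x 0 = T.hash) (hy : y 0 ≠ T.hash)
      (hy' : y 1 = T.hash) : Step T w x y p .s0 1 2
  | lt_end (hx : x 0 = T.hash) (hy : y 0 = T.hash) : Step T w x y .lt .s0 1 1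
  | cb_go {p} (hp : p = .s0 ∨ p = .cb) (hx : x 0 ≠ T.hash) (hy : y 0 ≠ T.hash)
      (hy' : y 1 ≠ T.hash) : Step T w x y p .cb 1 2
  | cb_end {p} (hp : p = .s0 ∨ p = .cb) (hx : x 0 = T.hash) (hy : y 0 ≠ T.hash)
      (hy' : y 1 ≠ T.hash) : Step T w x y p .s0 1 2
  | gt_two {p} (hp : p = .s0 ∨ p = .gt) (hy : y 0 ≠ T.hash) (hx : x 0 ≠ T.hash)
      (hx' : x 1 ≠ T.hash) : Step T w x y p .gt 2 1
  | gt_one (hx : x 0 ≠ T.hash) (hy : y 0 ≠ T.hash) : Step T w x y .gt .gt 1 1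
  | gt_end_two {p} (hp : p = .s0 ∨ p = .gt) (hy : y 0 = T.hash) (hx : x 0 ≠ T.hash)
      (hx' : x 1 = T.hash) : Step T w x y p .s0 2 1
  | gt_end (hx : x 0 = T.hash) (hy : y 0 = T.hash) : Step T w x y .gt .s0 1 1
  | cc_go {p} (hp : p = .s0 ∨ p = .cc) (hy : y 0 ≠ T.hash) (hx : x 0 ≠ T.hash)
      (hx' : x 1 ≠ T.hash) : Step T w x y p .cc 2 1
  | cc_end {p} (hp : p = .s0 ∨ p = .cc) (hy : y 0 = T.hash) (hx : x 0 ≠ T.hash)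
      (hx' : x 1 ≠ T.hash) : Step T w x y p .s0 2 1
  | scan_go {p} (hp : p = .s0 ∨ p = .scan) (hx : x 0 ≠ T.hash) (hy : y 0 ≠ T.hash) :
      Step T w x y p .scan 1 1
  | scan_ne {p} (hp : p = .s0 ∨ p = .scan) (hx : x 0 ≠ T.hash) (hy : y 0 ≠ T.hash)
      (hne : x 0 ≠ y 0) : Step T w x y p .sink 1 1
  | scan_bad {p} (hp : p = .s0 ∨ p = .scan) (hx : x 0 ≠ T.hash) (hx' : x 1 ≠ T.hash)
      (hy : y 0 ≠ T.hash) (hy' : y 1 ≠ T.hash) (hbad : T.Bad (x 0) (x 1)) :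
      Step T w x y p .sink 2 2
  | scan_end {p} (hp : p = .s0 ∨ p = .scan) (hx : x 0 ≠ T.hash) (hx' : x 1 = T.hash)
      (hy : y 0 ≠ T.hash) (hy' : y 1 = T.hash) (hE : x 0 ≠ T.E) : Step T w x y p .s0 2 2
  | sink_one (hx : x 0 ≠ T.hash) (hy : y 0 ≠ T.hash) : Step T w x y .sink .sink 1 1
  | sink_two (hx : x 0 ≠ T.hash) (hx' : x 1 ≠ T.hash) (hy : y 0 ≠ T.hash) :
      Step T w x y .sink .sink 2 1
  | sink_end (hx : x 0 = T.hash) (hy : y 0 = T.hash) : Step T w x y .sink .s0 1 1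
  | sink_end_two (hx : x 0 ≠ T.hash) (hx' : x 1 = T.hash) (hy : y 0 = T.hash) :
      Step T w x y .sink .s0 2 1
  | va_go {p} (hp : p = .s0 ∨ p = .va) (hx : x 0 = T.Z) (hy : y 0 ≠ T.hash)
      (hy' : y 1 ≠ T.hash) : Step T w x y p .va 1 2
  | va_wall {p} (hp : p = .s0 ∨ p = .va) (hx : x 0 = T.Z ∨ x 0 = T.Y) (hy : y 0 ≠ T.hash)
      (hy' : y 1 ≠ T.hash) (hW : y 0 = T.W ∨ y 1 = T.W) : Step T w x y p .sink 1 2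
  | va_mid (hx : x 0 = T.Y) (hy : y 0 ≠ T.hash) : Step T w x y .va .mid 1 1
  | mid_go (hx : x 0 ≠ T.hash) (hy : y 0 ≠ T.hash) : Step T w x y .mid .mid 1 1
  | mid_bad {p} (hp : (p = .va ∧ x 0 = T.Y) ∨ p = .mid) (hx : x 0 ≠ T.hash) (hx' : x 1 ≠ T.hash)
      (hx'' : x 2 ≠ T.hash) (hy : y 0 ≠ T.hash) (hy' : y 1 ≠ T.hash) (hy'' : y 2 ≠ T.hash)
      (hE : y 2 ≠ T.E) (hF : y 2 ≠ T.F (x 0) (x 1) (x 2)) : Step T w x y p .sink 3 3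
  | p1_go {p} (hp : p = .s0 ∨ p = .p1) (hx : x 0 ≠ T.hash) (hy : y 0 ≠ T.hash)
      (hy' : y 1 ≠ T.hash) (hE : y 0 ≠ T.E) (hE' : y 1 ≠ T.E) : Step T w x y p .p1 1 2
  | p2_go {p} (hp : p = .p1 ∨ p = .p2) (hx : x 0 ≠ T.hash) (hy : y 0 ≠ T.hash)
      (hE : y 0 ≠ T.E) : Step T w x y p .p2 1 1
  | p3_go {p} (hp : p = .p1 ∨ p = .p2 ∨ p = .p3) (hx : x 0 ≠ T.hash) (hx' : x 1 ≠ T.hash)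
      (hE : y 0 = T.E) : Step T w x y p .p3 2 1
  | p3_end (hx : x 0 ≠ T.hash) (hx' : x 1 = T.hash) (hy : y 0 = T.hash) :
      Step T w x y .p3 .s0 2 1
  | zs_go {p} (hp : p = .s0 ∨ p = .zs) (hx : x 0 = T.Z) (hy : y 0 ≠ T.hash) :
      Step T w x y p .zs 1 1
  | zs_chain (hx : x 0 = T.Y) (hy : y 0 ≠ T.hash) : Step T w x y .zs (.chain 0) 1 1
  | chain_go {i} (hw : w[i]? = some (x 0)) (hx : x 0 ≠ T.hash) (hy : y 0 ≠ T.hash) :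
      Step T w x y (.chain i) (.chain (i + 1)) 1 1
  | chain_ne {i a} (hw : w[i]? = some a) (hne : x 0 ≠ a) (hx : x 0 ≠ T.hash)
      (hy : y 0 ≠ T.hash) : Step T w x y (.chain i) .sink 1 1
  | chain_end {i} (hi : i ≤ w.length) (hx : x 0 = T.hash) (hy : y 0 = T.hash) :
      Step T w x y (.chain i) .s0 1 1
  | tail_go {i} (hi : i = w.length) (hx : x 0 = T.B) (hy : y 0 ≠ T.hash) :
      Step T w x y (.chain i) (.chain i) 1 1
  | tail_ne {i} (hi : i = w.length) (hB : x 0 ≠ T.B) (hW : x 0 ≠ T.W) (hx : x 0 ≠ T.hash)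
      (hy : y 0 ≠ T.hash) : Step T w x y (.chain i) .sink 1 1

variable {T : Rules A} {w : List A}

theorem Step.bounds {x y : ℕ → A} {p r : St} {k l : ℕ} (h : Step T w x y p r k l) :
    1 ≤ k ∧ k ≤ 3 ∧ 1 ≤ l ∧ l ≤ 3 := by
  cases h <;> omega

theorem Step.congr {x y x' y' : ℕ → A} {p r : St} {k l : ℕ} (h : Step T w x y p r k l)
    (hx : ∀ n < k, x n = x' n) (hy : ∀ n < l, y n = y' n) : Step T w x' y' p r k l := by
  cases h <;> [apply Step.s0_sink; apply Step.s0_end; apply Step.lt_two; apply Step.lt_one; apply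
    Step.lt_end_two; apply Step.lt_end; apply Step.cb_go; apply Step.cb_end; apply Step.gt_two;
    apply Step.gt_one; apply Step.gt_end_two; apply Step.gt_end; apply Step.cc_go; apply
    Step.cc_end; apply Step.scan_go; apply Step.scan_ne; apply Step.scan_bad; apply Step.scan_end;
    apply Step.sink_one; apply Step.sink_two; apply Step.sink_end; apply Step.sink_end_two; apply
    Step.va_go; apply Step.va_wall; apply Step.va_mid; apply Step.mid_go; apply Step.mid_bad;
    apply Step.p1_go; apply Step.p2_go; apply Step.p3_go; apply Step.p3_end; apply Step.zs_go;
    apply Step.zs_chain; apply Step.chain_go; apply Step.chain_ne; apply Step.chain_end; apply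
    Step.tail_go; apply Step.tail_ne] <;>
  first | assumption | (simp (disch := omega) only [← hx, ← hy]; assumption)

end DiagGifs

namespace DiagGifs

variable {A : Type} {T : Rules A} {w : List A}

/-- `Reach T w σ τ p i j r i' j'`: the automaton reading the tapes `σ`, `τ` can go from state `p`
at positions `i`, `j` to state `r` at positions `i'`, `j'`. -/
inductive Reach (T : Rules A) (w : List A) (σ τ : ℕ → A) (p : St) (i j : ℕ) : St → ℕ → ℕ → Prop
  | refl : Reach T w σ τ p i j p i j
  | tail {q r : St} {i' j' k l : ℕ} (h : Reach T w σ τ p i j q i' j')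
      (hs : Step T w (fun n => σ (i' + n)) (fun n => τ (j' + n)) q r k l) :
      Reach T w σ τ p i j r (i' + k) (j' + l)

namespace Reach

variable {σ τ σ' τ' : ℕ → A} {p q r : St} {i j i' j' a b : ℕ}

theorem trans (h : Reach T w σ τ p i j q i' j') (h' : Reach T w σ τ q i' j' r a b) :
    Reach T w σ τ p i j r a b := by
  induction h' with
  | refl => exact h
  | tail _ hs ih => exact ih.tail hs

theorem congr (h : Reach T w σ τ p i j q i' j') (hσ : ∀ n < i', σ n = σ' n)
    (hτ : ∀ n < j', τ n = τ' n) : Reach T w σ' τ' p i j q i' j' := by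
  induction h with
  | refl => exact .refl
  | tail _ hs ih =>
    exact (ih (fun n hn => hσ n (by omega)) (fun n hn => hτ n (by omega))).tail
      (hs.congr (fun n hn => hσ _ (by omega)) (fun n hn => hτ _ (by omega)))

theorem of_shift (h : Reach T w (fun n => σ (a + n)) (fun n => τ (b + n)) p i j q i' j') :
    Reach T w σ τ p (a + i) (b + j) q (a + i') (b + j') := by
  induction h with
  | refl => exact .refl
  | tail _ hs ih =>
    rw [← add_assoc, ← add_assoc]
    exact ih.tail (by simpa only [add_assoc] using hs)

theorem shift {m n : ℕ} (h : Reach T w σ τ p (a + i) (b + j) q m n) :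
    ∃ i' j', m = a + i' ∧ n = b + j' ∧
      Reach T w (fun n => σ (a + n)) (fun n => τ (b + n)) p i j q i' j' := by
  induction h with
  | refl => exact ⟨i, j, rfl, rfl, .refl⟩
  | tail _ hs ih =>
    obtain ⟨i', j', rfl, rfl, h⟩ := ih
    exact ⟨_, _, by rw [add_assoc], by rw [add_assoc],
      h.tail (by simpa only [add_assoc] using hs)⟩

theorem single {k l : ℕ} (hs : Step T w (fun n => σ (i + n)) (fun n => τ (j + n)) p r k l)
    (hi : i + k = i') (hj : j + l = j') : Reach T w σ τ p i j r i' j' := by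
  subst hi hj
  exact Reach.refl.tail hs

/-- Iterate a step that returns to the same state. -/
theorem iterate {k l : ℕ} (n : ℕ)
    (hs : ∀ m < n, Step T w (fun t => σ (i + k * m + t)) (fun t => τ (j + l * m + t)) p p k l) :
    Reach T w σ τ p i j p (i + k * n) (j + l * n) := by
  induction n with
  | zero => exact .refl
  | succ n ih =>
    rw [mul_add_one, mul_add_one, ← add_assoc, ← add_assoc]
    exact (ih fun m hm => hs m (by omega)).tail (hs n (by omega))

/-- Iterate, at least once, a step that is also available from the state `q`. -/
theorem iterate' {k l : ℕ} (n : ℕ) (hn : 1 ≤ n) (hp : p = q ∨ p = r)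
    (hs : ∀ m < n, ∀ p, p = q ∨ p = r →
      Step T w (fun t => σ (i + k * m + t)) (fun t => τ (j + l * m + t)) p r k l) :
    Reach T w σ τ p i j r (i + k * n) (j + l * n) := by
  obtain ⟨n, rfl⟩ := Nat.exists_eq_add_of_le hn
  clear hn
  induction n with
  | zero =>
    have := hs 0 (by omega) p hp
    exact single this (by simp) (by simp)
  | succ n ih =>
    rw [← add_assoc 1 n 1, mul_add_one, mul_add_one, ← add_assoc, ← add_assoc]
    exact (ih fun m hm => hs m (by omega)).tail (hs (1 + n) (by omega) _ (Or.inr rfl))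

end Reach

/-- A pair of positive end positions `e1, e2` such that the automaton, starting in `s0` at the
beginning of the tapes, can return to `s0` for the first time only at `e1, e2`. -/
inductive TokEnd (T : Rules A) (σ τ : ℕ → A) : ℕ → ℕ → Prop
  | both {a b : ℕ} (ha : ∀ n < a, σ n ≠ T.hash) (ha' : σ a = T.hash) (hb : ∀ n < b, τ n ≠ T.hash)
      (hb' : τ b = T.hash) (hab : b ≤ 2 * a + 1) (hba : a ≤ 2 * b + 1) :
      TokEnd T σ τ (a + 1) (b + 1)
  | left {a : ℕ} (ha : ∀ n < a, σ n ≠ T.hash) (ha' : σ a = T.hash)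
      (hb : ∀ n < 2 * a + 2, τ n ≠ T.hash) : TokEnd T σ τ (a + 1) (2 * a + 2)
  | right {b : ℕ} (hb : ∀ n < b, τ n ≠ T.hash) (hb' : τ b = T.hash)
      (ha : ∀ n < 2 * b + 2, σ n ≠ T.hash) : TokEnd T σ τ (2 * b + 2) (b + 1)

variable {σ τ σ' τ' : ℕ → A} {e1 e2 : ℕ}

theorem TokEnd.pos (h : TokEnd T σ τ e1 e2) : 1 ≤ e1 ∧ 1 ≤ e2 := by
  cases h <;> omega

theorem TokEnd.congr (h : TokEnd T σ τ e1 e2) (hσ : ∀ n < e1, σ n = σ' n)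
    (hτ : ∀ n < e2, τ n = τ' n) : TokEnd T σ' τ' e1 e2 := by
  cases h with
  | @both a b ha ha' hb hb' hab hba =>
    exact .both (fun n hn => hσ n (by omega) ▸ ha n hn) (hσ a (by omega) ▸ ha')
      (fun n hn => hτ n (by omega) ▸ hb n hn) (hτ b (by omega) ▸ hb') hab hba
  | @left a ha ha' hb =>
    exact .left (fun n hn => hσ n (by omega) ▸ ha n hn) (hσ a (by omega) ▸ ha')
      (fun n hn => hτ n (by omega) ▸ hb n hn)
  | @right b hb hb' ha =>
    exact .right (fun n hn => hτ n (by omega) ▸ hb n hn) (hτ b (by omega) ▸ hb')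
      (fun n hn => hσ n (by omega) ▸ ha n hn)

/-- Every pair of tapes with end markers far out has a token end. -/
theorem exists_tokEnd (hσ : ∃ n, σ n = T.hash) (hτ : ∃ n, τ n = T.hash) :
    ∃ e1 e2, TokEnd T σ τ e1 e2 := by
  classical
  have ha := fun n (hn : n < Nat.find hσ) => Nat.find_min hσ hn
  have hb := fun n (hn : n < Nat.find hτ) => Nat.find_min hτ hn
  have ha' := Nat.find_spec hσ
  have hb' := Nat.find_spec hτ
  by_cases h1 : Nat.find hτ ≤ 2 * Nat.find hσ + 1
  · by_cases h2 : Nat.find hσ ≤ 2 * Nat.find hτ + 1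
    · exact ⟨_, _, .both ha ha' hb hb' h1 h2⟩
    · exact ⟨_, _, .right hb hb' fun n hn => ha n (by omega)⟩
  · exact ⟨_, _, .left ha ha' fun n hn => hb n (by omega)⟩

set_option maxHeartbeats 1000000 in
/-- The shape of a step as far as end markers are concerned. -/
theorem Step.marker {x y : ℕ → A} {p r : St} {k l : ℕ} (h : Step T w x y p r k l) :
    (r ≠ .s0 ∧ (∀ n < k, x n ≠ T.hash) ∧ (∀ n < l, y n ≠ T.hash) ∧ k ≤ 2 * l ∧ l ≤ 2 * k ∧
      (r = .cb → (p = .s0 ∨ p = .cb) ∧ l = 2 * k) ∧ (r = .cc → (p = .s0 ∨ p = .cc) ∧ k = 2 * l)) ∨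
    (r = .s0 ∧ (∀ n, n + 1 < k → x n ≠ T.hash) ∧ x (k - 1) = T.hash ∧
      (∀ n, n + 1 < l → y n ≠ T.hash) ∧ y (l - 1) = T.hash ∧ k ≤ 2 * l ∧ l ≤ 2 * k) ∨
    (r = .s0 ∧ (p = .s0 ∨ p = .cb) ∧ k = 1 ∧ l = 2 ∧ x 0 = T.hash ∧ y 0 ≠ T.hash ∧ y 1 ≠ T.hash) ∨
    (r = .s0 ∧ (p = .s0 ∨ p = .cc) ∧ k = 2 ∧ l = 1 ∧ y 0 = T.hash ∧ x 0 ≠ T.hash ∧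
      x 1 ≠ T.hash) := by
  have hZ := T.Z_ne_hash
  have hY := T.Y_ne_hash
  have hB := T.B_ne_hash
  have hE := T.E_ne_hash
  have f1 : ∀ P : ℕ → Prop, (∀ n < 1, P n) ↔ P 0 := fun P => by simp
  have f2 : ∀ P : ℕ → Prop, (∀ n < 2, P n) ↔ P 0 ∧ P 1 := fun P =>
    ⟨fun h => ⟨h 0 (by omega), h 1 (by omega)⟩, fun h n hn => by interval_cases n <;> simp [h]⟩
  have f3 : ∀ P : ℕ → Prop, (∀ n < 3, P n) ↔ P 0 ∧ P 1 ∧ P 2 := fun P =>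
    ⟨fun h => ⟨h 0 (by omega), h 1 (by omega), h 2 (by omega)⟩,
      fun h n hn => by interval_cases n <;> simp [h]⟩
  have g1 : ∀ P : ℕ → Prop, (∀ n, n + 1 < 1 → P n) ↔ True := fun P => by simp
  have g2 : ∀ P : ℕ → Prop, (∀ n, n + 1 < 2 → P n) ↔ P 0 := fun P => by simp
  cases h
  all_goals first
    | (left; simp only [f1, f2, f3]; simp [*]; done)
    | (left; simp only [f1, f2]; rcases ‹x 0 = T.Z ∨ x 0 = T.Y› with h | h <;> simp [*]; done)
    | (right; left; simp only [g1, g2]; simp [*]; done)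
    | (right; right; left; simp [*]; done)
    | (right; right; right; simp [*])

end DiagGifs

namespace DiagGifs

variable {A : Type} {T : Rules A} {w : List A} {σ τ : ℕ → A} {e1 e2 : ℕ}

theorem eq_of_first {σ : ℕ → A} {c : A} {a b : ℕ} (ha : ∀ n < a, σ n ≠ c) (ha' : σ a = c)
    (hb : ∀ n < b, σ n ≠ c) (hb' : σ b = c) : a = b := by
  rcases lt_trichotomy a b with h | h | h
  · exact absurd ha' (hb a h)
  · exact h
  · exact absurd hb' (ha b h)

/-- The first return to `s0` happens at the token end. -/
theorem TokEnd.eq_or_reach (he : TokEnd T σ τ e1 e2) {r : St} {i j : ℕ}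
    (h : Reach T w σ τ .s0 0 0 r i j) :
    ((r = .s0 ∧ i = 0 ∧ j = 0) ∨ (r ≠ .s0 ∧ (∀ n < i, σ n ≠ T.hash) ∧ (∀ n < j, τ n ≠ T.hash) ∧
      i ≤ 2 * j ∧ j ≤ 2 * i ∧ (r = .cb → j = 2 * i) ∧ (r = .cc → i = 2 * j))) ∨
    Reach T w σ τ .s0 e1 e2 r i j := by
  induction h with
  | refl => left; left; simp
  | @tail q r i' j' k l h hs ih =>
    rcases ih with ih | ih
    swap
    · exact Or.inr (ih.tail hs)
    have hi : ∀ n < i', σ n ≠ T.hash := by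
      rcases ih with ⟨_, rfl, _⟩ | ih
      · simp
      · exact ih.2.1
    have hj : ∀ n < j', τ n ≠ T.hash := by
      rcases ih with ⟨_, _, rfl⟩ | ih
      · simp
      · exact ih.2.2.1
    have hcb : (q = .s0 ∨ q = .cb) → j' = 2 * i' := by
      rcases ih with ⟨_, rfl, rfl⟩ | ih
      · simp
      · rintro (h | h)
        · exact absurd h ih.1
        · exact ih.2.2.2.2.2.1 h
    have hcc : (q = .s0 ∨ q = .cc) → i' = 2 * j' := by
      rcases ih with ⟨_, rfl, rfl⟩ | ih
      · simp
      · rintro (h | h)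
        · exact absurd h ih.1
        · exact ih.2.2.2.2.2.2 h
    have hext : ∀ {ρ : ℕ → A} {m t : ℕ}, (∀ n < m, ρ n ≠ T.hash) → (∀ n < t, ρ (m + n) ≠ T.hash) →
        ∀ n < m + t, ρ n ≠ T.hash := by
      intro ρ m t h1 h2 n hn
      rcases lt_or_ge n m with h | h
      · exact h1 n h
      · obtain ⟨d, rfl⟩ := Nat.exists_eq_add_of_le h
        exact h2 d (by omega)
    have hb := hs.bounds
    rcases hs.marker with ⟨hr, hx, hy, h1, h2, h3, h4⟩ | ⟨hr, hx, hx', hy, hy', h1, h2⟩ |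
      ⟨hr, hq, rfl, rfl, hx, hy, hy'⟩ | ⟨hr, hq, rfl, rfl, hy, hx, hx'⟩
    · refine Or.inl (Or.inr ⟨hr, hext hi hx, hext hj hy, by omega, by omega, ?_, ?_⟩)
      · intro h
        have := hcb (h3 h).1
        have := (h3 h).2
        omega
      · intro h
        have := hcc (h4 h).1
        have := (h4 h).2
        omega
    · right
      have hσ := hext (t := k - 1) hi (fun n hn => hx n (by omega))
      have hτ := hext (t := l - 1) hj (fun n hn => hy n (by omega))
      subst hr
      suffices e1 = i' + k ∧ e2 = j' + l by
        rw [← this.1, ← this.2]; exact .refl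
      cases he with
      | both ha ha' hb hb' hab hba =>
        have := eq_of_first ha ha' hσ hx'
        have := eq_of_first hb hb' hτ hy'
        omega
      | left ha ha' hb =>
        have := eq_of_first ha ha' hσ hx'
        exact absurd hy' (hb _ (by omega))
      | right hb hb' ha =>
        have := eq_of_first hb hb' hτ hy'
        exact absurd hx' (ha _ (by omega))
    · right
      have hq := hcb hq
      have hτ := hext (t := 2) hj (fun n hn => by interval_cases n <;> assumption)
      subst hr
      suffices e1 = i' + 1 ∧ e2 = j' + 2 by
        rw [← this.1, ← this.2]; exact .refl
      cases he with
      | both ha ha' hb hb' hab hba =>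
        have := eq_of_first ha ha' hi hx
        exact absurd hb' (hτ _ (by omega))
      | left ha ha' hb =>
        have := eq_of_first ha ha' hi hx
        omega
      | @right b hb hb' ha =>
        have : i' ≥ 2 * b + 2 := by
          by_contra hlt
          exact ha i' (by omega) hx
        exact absurd hb' (hτ _ (by omega))
    · right
      have hq := hcc hq
      have hσ := hext (t := 2) hi (fun n hn => by interval_cases n <;> assumption)
      subst hr
      suffices e1 = i' + 2 ∧ e2 = j' + 1 by
        rw [← this.1, ← this.2]; exact .refl
      cases he with
      | both ha ha' hb hb' hab hba =>
        have := eq_of_first hb hb' hj hy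
        exact absurd ha' (hσ _ (by omega))
      | right hb hb' ha =>
        have := eq_of_first hb hb' hj hy
        omega
      | @left a ha ha' hb =>
        have : j' ≥ 2 * a + 2 := by
          by_contra hlt
          exact hb j' (by omega) hy
        exact absurd ha' (hσ _ (by omega))

theorem TokEnd.lt_or_reach (he : TokEnd T σ τ e1 e2) {r : St} {i j : ℕ}
    (h : Reach T w σ τ .s0 0 0 r i j) : i < e1 ∨ j < e2 ∨ Reach T w σ τ .s0 e1 e2 r i j := by
  rcases he.eq_or_reach h with (⟨_, rfl, _⟩ | ⟨_, hi, hj, _⟩) | h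
  · exact Or.inl (by have := he.pos; omega)
  · cases he with
    | both ha ha' hb hb' hab hba =>
      left; by_contra hlt; exact hi _ (by omega) ha'
    | left ha ha' hb =>
      left; by_contra hlt; exact hi _ (by omega) ha'
    | right hb hb' ha =>
      right; left; by_contra hlt; exact hj _ (by omega) hb'
  · exact Or.inr (Or.inr h)

end DiagGifs

namespace DiagGifs

variable {A : Type} {T : Rules A} {w : List A} {σ σ' τ : ℕ → A} {ℓ d M t : ℕ}

/-- A word `σ 0 … σ (ℓ - 1)` followed by an end marker is good if it is a (suitably padded) space
time diagram of a halting computation: `d` is the length of a row, `M` is the position of the first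
padding letter `E`, and `t` is the length of the blank part of the first row. -/
structure Good (T : Rules A) (w : List A) (σ : ℕ → A) (ℓ d M t : ℕ) : Prop where
  ne_hash : ∀ n < ℓ, σ n ≠ T.hash
  eq_hash : σ ℓ = T.hash
  not_bad : ∀ n < ℓ, ¬ T.Bad (σ n) (σ (n + 1))
  d_pos : 1 ≤ d
  eq_Z : ∀ n < d, σ n = T.Z
  eq_Y : σ d = T.Y
  eq_w : ∀ k a, w[k]? = some a → σ (d + 1 + k) = a
  eq_B : ∀ k < t, σ (d + 1 + w.length + k) = T.B
  eq_W : σ (d + 1 + w.length + t) = T.W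
  W_lt : d + 1 + w.length + t < ℓ
  ne_W : ∀ n < 2 * d + 2, n < ℓ → σ n ≠ T.W
  M_lt : M < ℓ
  eq_E : ∀ n, M ≤ n → n < ℓ → σ n = T.E
  ne_E : ∀ n < M, σ n ≠ T.E
  M_small : 3 * M < 2 * ℓ + 2
  rule : ∀ n, d ≤ n → n + d + 2 < M → σ (n + d + 2) = T.F (σ n) (σ (n + 1)) (σ (n + 2))

/-- Being good only depends on the letters up to the end marker. -/
theorem Good.congr (g : Good T w σ ℓ d M t) (h : ∀ n ≤ ℓ, σ' n = σ n) :
    Good T w σ' ℓ d M t := by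
  have hW := g.W_lt
  have hM := g.M_lt
  refine ⟨fun n hn => ?_, ?_, fun n hn => ?_, g.d_pos, fun n hn => ?_, ?_, fun k a ha => ?_,
    fun k hk => ?_, ?_, g.W_lt, fun n hn hn' => ?_, g.M_lt, fun n hn hn' => ?_, fun n hn => ?_,
    g.M_small, fun n hn hn' => ?_⟩
  · rw [h _ (by omega)]; exact g.ne_hash n hn
  · rw [h _ (by omega)]; exact g.eq_hash
  · rw [h _ (by omega), h _ (by omega)]; exact g.not_bad n hn
  · rw [h _ (by omega)]; exact g.eq_Z n hn
  · rw [h _ (by omega)]; exact g.eq_Y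
  · have := (List.getElem?_eq_some_iff.1 ha).1
    rw [h _ (by omega)]; exact g.eq_w k a ha
  · rw [h _ (by omega)]; exact g.eq_B k hk
  · rw [h _ (by omega)]; exact g.eq_W
  · rw [h _ (by omega)]; exact g.ne_W n hn hn'
  · rw [h _ (by omega)]; exact g.eq_E n hn hn'
  · rw [h _ (by omega)]; exact g.ne_E n hn
  · rw [h _ (by omega), h _ (by omega), h _ (by omega), h _ (by omega)]; exact g.rule n hn hn'

/-- The configurations that can be reached when both tapes start with the same good word. -/
def GoodInv (L d M t i j : ℕ) : St → Prop
  | .s0 => i = 0 ∧ j = 0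
  | .scan => i = j
  | .sink => False
  | .lt => i < j
  | .cb => i < j
  | .gt => j < i
  | .cc => j < i
  | .va => j = 2 * i ∧ 1 ≤ i ∧ i ≤ d
  | .mid => j = i + d ∧ d < i
  | .p1 => j = 2 * i ∧ 1 ≤ i ∧ j ≤ M
  | .p2 => j ≤ M ∧ 2 * j ≤ M + 2 * i
  | .p3 => M < j ∧ 4 * j ≤ 3 * M + 2 * i
  | .zs => i = j ∧ 1 ≤ i ∧ i ≤ d
  | .chain k => i = j ∧ ((k < L ∧ i = d + 1 + k) ∨
      (k = L ∧ d + 1 + L ≤ i ∧ i ≤ d + 1 + L + t))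

set_option maxHeartbeats 1000000 in
theorem Good.inv_step (g : Good T w σ ℓ d M t) (hτ : ∀ n ≤ ℓ, τ n = σ n) {p r : St}
    {i j k l : ℕ} (hi : i ≤ ℓ) (hj : j ≤ ℓ) (hp : GoodInv w.length d M t i j p)
    (hs : Step T w (fun n => σ (i + n)) (fun n => τ (j + n)) p r k l) :
    i + k ≤ ℓ ∧ j + l ≤ ℓ ∧ GoodInv w.length d M t (i + k) (j + l) r := by
  have hd := g.d_pos
  have hMs := g.M_small
  have hWlt := g.W_lt
  have adv : ∀ {n}, n ≤ ℓ → σ n ≠ T.hash → n + 1 ≤ ℓ := by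
    intro n hn h
    rcases hn.lt_or_eq with h' | rfl
    · exact h'
    · exact absurd g.eq_hash h
  have pin : ∀ {n}, n ≤ ℓ → σ n = T.hash → n = ℓ := by
    intro n hn h
    by_contra hne
    exact g.ne_hash n (by omega) h
  have adv' : ∀ {n}, n ≤ ℓ → τ n ≠ T.hash → n + 1 ≤ ℓ := fun hn h => adv hn (hτ _ hn ▸ h)
  have pin' : ∀ {n}, n ≤ ℓ → τ n = T.hash → n = ℓ := fun hn h => pin hn (hτ _ hn ▸ h)
  have notE : ∀ {n}, n + 1 ≤ ℓ → τ n ≠ T.E → n < M := by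
    intro n hn h
    by_contra hlt
    exact h (by rw [hτ n (by omega)]; exact g.eq_E n (by omega) (by omega))
  have isE : ∀ {n}, n ≤ ℓ → τ n = T.E → M ≤ n := by
    intro n hn h
    by_contra hlt
    exact g.ne_E n (by omega) (hτ n hn ▸ h)
  have isZ : ∀ {n}, n ≤ d → σ n = T.Z → n + 1 ≤ d := by
    intro n hn h
    rcases hn.lt_or_eq with h' | rfl
    · exact h'
    · exact absurd (h.symm.trans g.eq_Y) T.Z_ne_Y
  have isY : ∀ {n}, n ≤ d → σ n = T.Y → n = d := by
    intro n hn h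
    by_contra hne
    exact T.Z_ne_Y ((g.eq_Z n (by omega)).symm.trans h)
  cases hs with
  | s0_sink hZ hx hy => 
    obtain ⟨rfl, rfl⟩ := hp
    exact absurd (g.eq_Z 0 (by omega)) hZ
  | s0_end hx hy =>
    obtain ⟨rfl, rfl⟩ := hp
    have := pin hi hx
    omega
  | lt_two hq hx hy hy' =>
    have := adv hi hx
    have h1 := adv' hj hy
    have := adv' h1 hy'
    rcases hq with rfl | rfl <;> simp only [GoodInv] at * <;> omega
  | lt_one hx hy =>
    have := adv hi hx
    have h1 := adv' hj hy
    simp only [GoodInv] at *; omega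
  | lt_end_two hq hx hy hy' =>
    have := pin hi hx
    rcases hq with rfl | rfl <;> simp only [GoodInv] at * <;> omega
  | lt_end hx hy =>
    have := pin hi hx
    simp only [GoodInv] at *; omega
  | cb_go hq hx hy hy' =>
    have := adv hi hx
    have h1 := adv' hj hy
    have := adv' h1 hy'
    rcases hq with rfl | rfl <;> simp only [GoodInv] at * <;> omega
  | cb_end hq hx hy hy' =>
    have := pin hi hx
    rcases hq with rfl | rfl <;> simp only [GoodInv] at * <;> omega
  | gt_two hq hy hx hx' =>
    have h1 := adv hi hx
    have := adv' hj hy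
    have := adv h1 hx'
    rcases hq with rfl | rfl <;> simp only [GoodInv] at * <;> omega
  | gt_one hx hy =>
    have := adv hi hx
    have h1 := adv' hj hy
    simp only [GoodInv] at *; omega
  | gt_end_two hq hy hx hx' =>
    have := pin' hj hy
    rcases hq with rfl | rfl <;> simp only [GoodInv] at * <;> omega
  | gt_end hx hy =>
    have := pin' hj hy
    simp only [GoodInv] at *; omega
  | cc_go hq hy hx hx' =>
    have h1 := adv hi hx
    have := adv' hj hy
    have := adv h1 hx'
    rcases hq with rfl | rfl <;> simp only [GoodInv] at * <;> omega
  | cc_end hq hy hx hx' =>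
    have := pin' hj hy
    rcases hq with rfl | rfl <;> simp only [GoodInv] at * <;> omega
  | scan_go hq hx hy =>
    have := adv hi hx
    have := adv' hj hy
    rcases hq with rfl | rfl <;> simp only [GoodInv] at * <;> omega
  | scan_ne hq hx hy hne =>
    have : i = j := by rcases hq with rfl | rfl <;> simp only [GoodInv] at * <;> omega
    subst this
    exact absurd (hτ i hi).symm hne
  | scan_bad hq hx hx' hy hy' hbad =>
    exact absurd hbad (g.not_bad _ (adv hi hx))
  | scan_end hq hx hx' hy hy' hE =>
    exact absurd (Or.inr (Or.inr (Or.inl ⟨hx', hE⟩))) (g.not_bad _ (adv hi hx))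
  | sink_one hx hy => exact hp.elim
  | sink_two hx hx' hy => exact hp.elim
  | sink_end hx hy => exact hp.elim
  | sink_end_two hx hx' hy => exact hp.elim
  | va_go hq hx hy hy' =>
    have : i ≤ d := by rcases hq with rfl | rfl <;> simp only [GoodInv] at * <;> omega
    have := isZ this hx
    have := g.M_lt
    have := adv hi (hx.trans_ne T.Z_ne_hash)
    have h1 := adv' hj hy
    have := adv' h1 hy'
    rcases hq with rfl | rfl <;> simp only [GoodInv] at * <;> omega
  | va_wall hq hx hy hy' hW =>
    have : i ≤ d ∧ j = 2 * i := by
      rcases hq with rfl | rfl <;> simp only [GoodInv] at * <;> omega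
    have h1 := adv' hj hy
    have h2 := adv' h1 hy'
    rcases hW with hW | hW
    · exact absurd (hτ j hj ▸ hW) (g.ne_W _ (by omega) (by omega))
    · exact absurd (hτ _ h1 ▸ hW) (g.ne_W _ (by omega) (by omega))
  | va_mid hx hy =>
    have := isY hp.2.2 hx
    have := adv hi (hx.trans_ne T.Y_ne_hash)
    have := adv' hj hy
    simp only [GoodInv] at *; omega
  | mid_go hx hy =>
    have := adv hi hx
    have := adv' hj hy
    simp only [GoodInv] at *; omega
  | mid_bad hq hx hx' hx'' hy hy' hy'' hE hF =>
    have : j = i + d ∧ d ≤ i := by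
      rcases hq with ⟨rfl, hY⟩ | rfl
      · have := isY hp.2.2 hY
        simp only [GoodInv] at hp
        omega
      · simp only [GoodInv] at hp
        omega
    obtain ⟨rfl, hdi⟩ := this
    have h1 := adv' hj hy
    have h2 := adv' h1 hy'
    have h3 := adv' h2 hy''
    have h4 := notE h3 hE
    refine absurd ?_ hF
    have := g.rule i hdi h4
    rw [← hτ _ h2] at this
    exact this
  | p1_go hq hx hy hy' hE hE' =>
    have := adv hi hx
    have h1 := adv' hj hy
    have h2 := adv' h1 hy'
    have := notE h2 hE'
    rcases hq with rfl | rfl <;> simp only [GoodInv] at * <;> omega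
  | p2_go hq hx hy hE =>
    have := adv hi hx
    have h1 := adv' hj hy
    have := notE h1 hE
    rcases hq with rfl | rfl <;> simp only [GoodInv] at * <;> omega
  | p3_go hq hx hx' hE =>
    have h1 := adv hi hx
    have := adv h1 hx'
    have := adv' hj (hE.trans_ne T.E_ne_hash)
    have := isE hj hE
    rcases hq with rfl | rfl | rfl <;> simp only [GoodInv] at * <;> omega
  | p3_end hx hx' hy =>
    have h1 := adv hi hx
    have := pin h1 hx'
    have := pin' hj hy
    simp only [GoodInv] at hp; omega
  | zs_go hq hx hy =>
    have : i ≤ d := by rcases hq with rfl | rfl <;> simp only [GoodInv] at * <;> omega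
    have := isZ this hx
    have := adv hi (hx.trans_ne T.Z_ne_hash)
    have := adv' hj hy
    rcases hq with rfl | rfl <;> simp only [GoodInv] at * <;> omega
  | zs_chain hx hy =>
    have := isY hp.2.2 hx
    have := adv hi (hx.trans_ne T.Y_ne_hash)
    have := adv' hj hy
    simp only [GoodInv] at *; omega
  | @chain_go k hw hx hy =>
    have := adv hi hx
    have := adv' hj hy
    have : k < w.length := (List.getElem?_eq_some_iff.1 hw).1
    simp only [GoodInv] at *; omega
  | @chain_ne k a hw hne hx hy =>
    have hk : k < w.length := (List.getElem?_eq_some_iff.1 hw).1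
    have : i = d + 1 + k := by simp only [GoodInv] at hp; omega
    subst this
    exact absurd (g.eq_w k a hw) hne
  | chain_end hk hx hy =>
    have := pin hi hx
    simp only [GoodInv] at hp; omega
  | tail_go hk hx hy =>
    have : i ≠ d + 1 + w.length + t := by
      rintro rfl
      exact T.B_ne_W (hx.symm.trans g.eq_W)
    have := adv hi (hx.trans_ne T.B_ne_hash)
    have := adv' hj hy
    simp only [GoodInv] at *; omega
  | tail_ne hk hB hW hx hy =>
    simp only [GoodInv] at hp
    obtain ⟨s, rfl⟩ : ∃ s, i = d + 1 + w.length + s := Nat.exists_eq_add_of_le (by omega)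
    rcases (show s ≤ t by omega).lt_or_eq with h | rfl
    · exact absurd (g.eq_B s h) hB
    · exact absurd g.eq_W hW

/-- A good word on both tapes is never passed. -/
theorem Good.le_of_reach (g : Good T w σ ℓ d M t) (hτ : ∀ n ≤ ℓ, τ n = σ n) {r : St} {i j : ℕ}
    (h : Reach T w σ τ .s0 0 0 r i j) : i ≤ ℓ := by
  suffices i ≤ ℓ ∧ j ≤ ℓ ∧ GoodInv w.length d M t i j r from this.1
  induction h with
  | refl => simp [GoodInv]
  | tail _ hs ih => exact g.inv_step hτ ih.1 ih.2.1 ih.2.2 hs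

end DiagGifs

namespace DiagGifs

variable {A : Type} {T : Rules A} {w : List A} {σ τ : ℕ → A} {ℓ : ℕ}

theorem reach_of_sink (hσ : ∀ n < ℓ, σ n ≠ T.hash) (hℓ : σ ℓ = T.hash) {i j : ℕ} (hij : i ≤ j)
    (hj : j ≤ ℓ) (h : 2 * j ≤ ℓ + 1 + i) : Reach T w σ σ .sink i j .s0 (ℓ + 1) (ℓ + 1) := by
  obtain ⟨m, hm⟩ : ∃ m, ℓ = j + m := Nat.exists_eq_add_of_le hj
  induction m generalizing i j with
  | zero =>
    obtain rfl | hlt := hij.eq_or_lt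
    · exact .single (.sink_end (by simp_all) (by simp_all)) (by omega) (by omega)
    · obtain rfl : j = i + 1 := by omega
      refine .single (.sink_end_two (hσ _ (by omega)) (by simp_all) (by simp_all)) (by omega)
        (by omega)
  | succ m ih =>
    obtain rfl | hlt := hij.eq_or_lt
    · exact (Reach.single (.sink_one (hσ _ (by omega)) (hσ _ (by omega))) rfl rfl).trans
        (ih (by omega) (by omega) (by omega) (by omega))
    · exact (Reach.single (.sink_two (hσ _ (by omega)) (hσ _ (by omega)) (hσ _ (by omega)))
        rfl rfl).trans (ih (by omega) (by omega) (by omega) (by omega))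

theorem exists_good_of_not_reach (hσ : ∀ n < ℓ, σ n ≠ T.hash)
    (hℓ : σ ℓ = T.hash) (hN : ¬ Reach T w σ σ .s0 0 0 .s0 (ℓ + 1) (ℓ + 1)) :
    ∃ d M t, Good T w σ ℓ d M t := by
  classical
  have nosink : ∀ {i j : ℕ}, i ≤ j → j ≤ ℓ → 2 * j ≤ ℓ + 1 + i →
      ¬ Reach T w σ σ .s0 0 0 .sink i j := fun hij hj h hr =>
    hN (hr.trans (reach_of_sink hσ hℓ hij hj h))
  have hpos : ℓ ≠ 0 := by
    rintro rfl
    exact hN (.single (.s0_end (by simpa) (by simpa)) rfl rfl)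
  have hZ0 : σ 0 = T.Z := by
    by_contra h
    exact nosink le_rfl (by omega) (by omega)
      (.single (.s0_sink h (hσ _ (by omega)) (hσ _ (by omega))) rfl rfl)
  -- no bad pairs
  have scan : ∀ n ≤ ℓ, ∃ p, (p = .s0 ∨ p = .scan) ∧ Reach T w σ σ .s0 0 0 p n n := by
    intro n hn
    rcases Nat.eq_zero_or_pos n with rfl | h0
    · exact ⟨_, Or.inl rfl, .refl⟩
    · refine ⟨_, Or.inr rfl, ?_⟩
      have := Reach.iterate' (T := T) (w := w) (σ := σ) (τ := σ) (i := 0) (j := 0) (q := .s0)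
        (r := .scan) (k := 1) (l := 1) n h0 (Or.inl rfl) fun m hm p hp =>
          .scan_go hp (hσ _ (by omega)) (hσ _ (by omega))
      simpa using this
  have hbad : ∀ n < ℓ, ¬ T.Bad (σ n) (σ (n + 1)) := by
    intro n hn hb
    obtain ⟨p, hp, hr⟩ := scan n hn.le
    rcases (show n + 1 ≤ ℓ from hn).lt_or_eq with h | h
    · refine nosink le_rfl (show n + 2 ≤ ℓ from h) (by omega)
        (hr.trans (.single (.scan_bad hp (hσ _ (by omega)) (hσ _ (by omega)) (hσ _ (by omega))
          (hσ _ (by omega)) hb) rfl rfl))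
    · have hh : σ (n + 1) = T.hash := h ▸ hℓ
      have hE : σ n ≠ T.E := by
        rcases hb with hb | hb | hb | hb
        · exact absurd (hb.1.symm.trans hh) T.E_ne_hash
        · exact absurd hh hb.2.2
        · exact hb.2
        · exact hb.1.trans_ne T.Z_ne_E
      refine hN (hr.trans (.single (.scan_end hp (hσ _ (by omega)) hh (hσ _ (by omega)) hh hE)
        (by omega) (by omega)))
  -- the position of the first letter different from `Z`
  have hexd : ∃ n, σ n ≠ T.Z := ⟨ℓ, hℓ ▸ T.Z_ne_hash.symm⟩
  obtain ⟨d, hd, hdZ⟩ : ∃ d, σ d ≠ T.Z ∧ ∀ n < d, σ n = T.Z :=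
    ⟨_, Nat.find_spec hexd, fun n hn => not_not.1 (Nat.find_min hexd hn)⟩
  have hd1 : 1 ≤ d := by
    rcases Nat.eq_zero_or_pos d with rfl | h
    · exact absurd hZ0 hd
    · exact h
  have hdℓ : d ≤ ℓ := by
    by_contra h
    exact T.Z_ne_hash ((hdZ ℓ (by omega)).symm.trans hℓ)
  have hdY : σ d = T.Y := by
    by_contra h
    refine hbad (d - 1) (by omega) (Or.inr (Or.inr (Or.inr ⟨hdZ _ (by omega), ?_⟩)))
    rw [show d - 1 + 1 = d by omega]
    exact ⟨hd, h⟩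
  -- the position of the first letter `E`
  have hlast : σ (ℓ - 1) = T.E := by
    by_contra h
    refine hbad (ℓ - 1) (by omega) (Or.inr (Or.inr (Or.inl ⟨?_, h⟩)))
    rwa [show ℓ - 1 + 1 = ℓ by omega]
  have hexM : ∃ n, σ n = T.E := ⟨_, hlast⟩
  obtain ⟨M, hM, hMmin⟩ : ∃ M, σ M = T.E ∧ ∀ n < M, σ n ≠ T.E :=
    ⟨_, Nat.find_spec hexM, fun n hn => Nat.find_min hexM hn⟩
  have hMℓ : M < ℓ := by
    by_contra h
    exact hMmin (ℓ - 1) (by omega) hlast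
  have hEs : ∀ n, M ≤ n → n < ℓ → σ n = T.E := by
    intro n hn
    induction n, hn using Nat.le_induction with
    | base => exact fun _ => hM
    | succ n hn ih =>
      intro hlt
      by_contra h
      exact hbad n (by omega) (Or.inr (Or.inl ⟨ih (by omega), h, hσ _ hlt⟩))
  have hM0 : M ≠ 0 := by
    rintro rfl
    exact T.Z_ne_E (hZ0.symm.trans hM)
  have hH : T.H (σ (M - 1)) := by
    by_contra h
    refine hbad (M - 1) (by omega) (Or.inl ⟨?_, h, hMmin _ (by omega)⟩)
    rwa [show M - 1 + 1 = M by omega]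
  have hdM : d < M := by
    by_contra h
    rcases (show M ≤ d by omega).lt_or_eq with h | rfl
    · exact T.Z_ne_E ((hdZ _ h).symm.trans hM)
    · exact T.Y_ne_E (hdY.symm.trans hM)
  -- the padding is long enough
  have hMs : 3 * M < 2 * ℓ + 2 := by
    by_contra hlt
    obtain ⟨a, rfl⟩ : ∃ a, ℓ = M + a := Nat.exists_eq_add_of_le hMℓ.le
    have h1 := Reach.iterate' (T := T) (w := w) (σ := σ) (τ := σ) (i := 0) (j := 0) (q := .s0)
        (r := .p1) (k := 1) (l := 2) (a + 1) (by omega) (Or.inl rfl) fun m hm p hp =>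
          .p1_go hp (hσ _ (by omega)) (hσ _ (by omega)) (hσ _ (by omega)) (hMmin _ (by omega))
            (hMmin _ (by omega))
    obtain ⟨b, rfl⟩ : ∃ b, M = 2 * (a + 1) + b := Nat.exists_eq_add_of_le (by omega)
    obtain ⟨p, hp, h2⟩ : ∃ p, (p = .p1 ∨ p = .p2) ∧
        Reach T w σ σ .s0 0 0 p (a + 1 + b) (2 * (a + 1) + b) := by
      rcases Nat.eq_zero_or_pos b with rfl | hb
      · exact ⟨_, Or.inl rfl, by simpa using h1⟩
      · refine ⟨_, Or.inr rfl, h1.trans ?_⟩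
        have := Reach.iterate' (T := T) (w := w) (σ := σ) (τ := σ) (i := a + 1)
          (j := 2 * (a + 1)) (q := .p1) (r := .p2) (k := 1) (l := 1) b hb (Or.inl rfl)
          fun m hm p hp => .p2_go hp (hσ _ (by omega)) (hσ _ (by omega)) (hMmin _ (by omega))
        simpa using this
    have h3 := Reach.iterate' (T := T) (w := w) (σ := σ) (τ := σ) (i := a + 1 + b)
          (j := 2 * (a + 1) + b) (q := p) (r := .p3) (k := 2) (l := 1) a (by omega) (Or.inl rfl)
          fun m hm p' hp' => .p3_go (by
            rcases hp' with rfl | rfl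
            · rcases hp with rfl | rfl
              · exact Or.inl rfl
              · exact Or.inr (Or.inl rfl)
            · exact Or.inr (Or.inr rfl)) (hσ _ (by omega)) (hσ _ (by omega))
              (hEs _ (by omega) (by omega))
    refine hN ((h2.trans h3).trans (.single (.p3_end (hσ _ (by omega)) ?_ ?_) (by omega)
      (by omega)))
    · rw [← hℓ]; congr 1; omega
    · rw [← hℓ]; congr 1; omega
  -- walls
  have hva : ∀ n ≤ d, 2 * n ≤ ℓ → ∃ p, (p = .s0 ∨ p = .va) ∧
      (1 ≤ n → p = .va) ∧ Reach T w σ σ .s0 0 0 p n (2 * n) := by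
    intro n hn hn'
    rcases Nat.eq_zero_or_pos n with rfl | h0
    · exact ⟨_, Or.inl rfl, by simp, .refl⟩
    · refine ⟨_, Or.inr rfl, fun _ => rfl, ?_⟩
      have := Reach.iterate' (T := T) (w := w) (σ := σ) (τ := σ) (i := 0) (j := 0) (q := .s0)
        (r := .va) (k := 1) (l := 2) n h0 (Or.inl rfl) fun m hm p hp =>
          .va_go hp (hdZ _ (by omega)) (hσ _ (by omega)) (hσ _ (by omega))
      simpa using this
  have hW : ∀ n < 2 * d + 2, n < ℓ → σ n ≠ T.W := by
    intro n hn hnℓ h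
    have hnM : n < M := by
      by_contra hlt
      exact T.W_ne_E (h.symm.trans (hEs n (by omega) hnℓ))
    have hnM' : n ≠ M - 1 := by
      rintro rfl
      exact T.not_H_W (h ▸ hH)
    obtain ⟨p, hp, -, hr⟩ := hva (n / 2) (by omega) (by omega)
    refine nosink (i := n / 2 + 1) (j := 2 * (n / 2) + 2) (by omega) (by omega) (by omega)
      (hr.trans (.single (.va_wall hp ?_ (hσ _ (by omega)) (hσ _ (by omega)) ?_) rfl rfl))
    · rcases (show n / 2 ≤ d by omega).lt_or_eq with h | h
      · exact Or.inl (hdZ _ h)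
      · exact Or.inr (show σ (n / 2) = T.Y by rw [h, hdY])
    · rcases Nat.mod_two_eq_zero_or_one n with h' | h'
      · left; show σ _ = _; rw [← h]; congr 1; omega
      · right; show σ _ = _; rw [← h]; congr 1; omega
  -- the local rule
  have hrule : ∀ n, d ≤ n → n + d + 2 < M →
      σ (n + d + 2) = T.F (σ n) (σ (n + 1)) (σ (n + 2)) := by
    intro n hn hnM
    by_contra hF
    obtain ⟨p, -, hp', hr⟩ := hva d le_rfl (by omega)
    obtain rfl := hp' hd1
    obtain ⟨q, hq, hr'⟩ : ∃ q, ((q = .va ∧ σ n = T.Y) ∨ q = .mid) ∧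
        Reach T w σ σ .s0 0 0 q n (n + d) := by
      rcases hn.lt_or_eq with h | rfl
      · refine ⟨_, Or.inr rfl,
          (hr.trans (.single (.va_mid hdY (hσ _ (by omega))) rfl rfl)).trans ?_⟩
        have := Reach.iterate (T := T) (w := w) (σ := σ) (τ := σ) (i := d + 1) (j := 2 * d + 1)
          (p := .mid) (k := 1) (l := 1) (n - (d + 1)) fun m hm =>
          .mid_go (hσ _ (by omega)) (hσ _ (by omega))
        rwa [show d + 1 + 1 * (n - (d + 1)) = n by omega,
          show 2 * d + 1 + 1 * (n - (d + 1)) = n + d by omega] at this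
      · exact ⟨_, Or.inl ⟨rfl, hdY⟩, by rwa [← two_mul]⟩
    exact nosink (i := n + 3) (j := n + d + 3) (by omega) (by omega) (by omega)
      (hr'.trans (.single (.mid_bad hq (hσ _ (by omega)) (hσ _ (by omega)) (hσ _ (by omega))
        (hσ _ (by omega)) (hσ _ (by omega)) (hσ _ (by omega)) (hMmin _ (by omega)) hF) rfl rfl))
  -- the first row
  have hzs : Reach T w σ σ .s0 0 0 (.chain 0) (d + 1) (d + 1) := by
    have := Reach.iterate' (T := T) (w := w) (σ := σ) (τ := σ) (i := 0) (j := 0) (q := .s0)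
        (r := .zs) (k := 1) (l := 1) d hd1 (Or.inl rfl) fun m hm p hp =>
          .zs_go hp (by simpa using hdZ _ (by omega)) (hσ _ (by omega))
    simp only [zero_add, one_mul] at this
    exact this.trans (.single (.zs_chain hdY (hσ _ (by omega))) rfl rfl)
  have hch : ∀ k ≤ w.length, (∀ m < k, w[m]? = some (σ (d + 1 + m))) ∧ d + 1 + k ≤ ℓ ∧
      Reach T w σ σ .s0 0 0 (.chain k) (d + 1 + k) (d + 1 + k) := by
    intro k
    induction k with
    | zero => exact fun _ => ⟨by simp, by omega, hzs⟩
    | succ k ih =>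
      intro hk
      obtain ⟨h1, h2, h3⟩ := ih (by omega)
      have hlt : d + 1 + k < ℓ := by
        rcases h2.lt_or_eq with h | h
        · exact h
        · refine absurd (h3.trans (.single (.chain_end (by omega) ?_ ?_) ?_ ?_)) hN
          · simpa [h] using hℓ
          · simpa [h] using hℓ
          · omega
          · omega
      have hwk : w[k]? = some (σ (d + 1 + k)) := by
        obtain ⟨a, ha⟩ : ∃ a, w[k]? = some a := ⟨_, List.getElem?_eq_getElem (by omega)⟩
        by_contra hne
        rw [ha, Option.some_inj] at hne
        exact nosink le_rfl (show d + 1 + k + 1 ≤ ℓ by omega) (by omega) (h3.trans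
          (.single (.chain_ne ha (Ne.symm hne) (hσ _ (by omega)) (hσ _ (by omega))) rfl rfl))
      refine ⟨?_, by omega, h3.trans (.single (.chain_go hwk (hσ _ (by omega)) (hσ _ (by omega)))
        rfl rfl)⟩
      intro m hm
      rcases (Nat.lt_succ_iff.1 hm).lt_or_eq with h | rfl
      · exact h1 m h
      · exact hwk
  obtain ⟨hwσ, hwℓ, hL⟩ := hch _ le_rfl
  have hext : ∃ t, σ (d + 1 + w.length + t) ≠ T.B := by
    refine ⟨ℓ - (d + 1 + w.length), ?_⟩
    rw [show d + 1 + w.length + (ℓ - (d + 1 + w.length)) = ℓ by omega, hℓ]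
    exact T.B_ne_hash.symm
  obtain ⟨t, ht, htB⟩ : ∃ t, σ (d + 1 + w.length + t) ≠ T.B ∧
      ∀ k < t, σ (d + 1 + w.length + k) = T.B :=
    ⟨_, Nat.find_spec hext, fun n hn => not_not.1 (Nat.find_min hext hn)⟩
  have htℓ : d + 1 + w.length + t ≤ ℓ := by
    by_contra h
    have := htB (ℓ - (d + 1 + w.length)) (by omega)
    rw [show d + 1 + w.length + (ℓ - (d + 1 + w.length)) = ℓ by omega, hℓ] at this
    exact T.B_ne_hash this.symm
  have htr : Reach T w σ σ .s0 0 0 (.chain w.length) (d + 1 + w.length + t)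
      (d + 1 + w.length + t) := by
    have := Reach.iterate (T := T) (w := w) (σ := σ) (τ := σ) (i := d + 1 + w.length)
      (j := d + 1 + w.length) (p := .chain w.length) (k := 1) (l := 1) t fun m hm =>
      .tail_go rfl (by simpa using htB _ (by omega)) (hσ _ (by omega))
    rw [one_mul] at this
    exact hL.trans this
  have htℓ : d + 1 + w.length + t < ℓ := by
    rcases htℓ.lt_or_eq with h | h
    · exact h
    · refine absurd (htr.trans (.single (.chain_end le_rfl ?_ ?_) ?_ ?_)) hN
      · simpa [h] using hℓ
      · simpa [h] using hℓ
      · omega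
      · omega
  refine ⟨d, M, t, hσ, hℓ, hbad, hd1, hdZ, hdY, ?_, htB, ?_, htℓ, hW, hMℓ, hEs, hMmin, hMs, hrule⟩
  · intro k a ha
    have hk : k < w.length := (List.getElem?_eq_some_iff.1 ha).1
    exact (Option.some_inj.1 (ha.symm.trans (hwσ k hk))).symm
  · by_contra h
    exact nosink le_rfl (show d + 1 + w.length + t + 1 ≤ ℓ by omega) (by omega) (htr.trans
          (.single (.tail_ne rfl ht h (hσ _ (by omega)) (hσ _ (by omega))) rfl rfl))

end DiagGifs

namespace DiagGifs

variable {A : Type} {T : Rules A} {w : List A} {σ τ : ℕ → A} {e1 e2 : ℕ}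

/-- If there are no good words, every token can be read. -/
theorem TokEnd.reach
    (hno : ∀ (ρ : ℕ → A) (ℓ d M t : ℕ), ¬ Good T w ρ ℓ d M t) (he : TokEnd T σ τ e1 e2) :
    Reach T w σ τ .s0 0 0 .s0 e1 e2 := by
  cases he with
  | @both a b ha ha' hb hb' hab hba =>
    rcases lt_trichotomy a b with h | rfl | h
    · rcases Nat.lt_or_ge a (b - a) with h' | h'
      · obtain rfl : b = 2 * a + 1 := by omega
        obtain ⟨p, hp, hr⟩ : ∃ p, (p = .s0 ∨ p = .lt) ∧ Reach T w σ τ .s0 0 0 p a (2 * a) := by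
          rcases Nat.eq_zero_or_pos a with rfl | h0
          · exact ⟨_, Or.inl rfl, .refl⟩
          · refine ⟨_, Or.inr rfl, ?_⟩
            have := Reach.iterate' (T := T) (w := w) (σ := σ) (τ := τ) (i := 0) (j := 0)
              (q := .s0) (r := .lt) (k := 1) (l := 2) a h0 (Or.inl rfl) fun m hm p hp =>
                .lt_two hp (ha _ (by omega)) (hb _ (by omega)) (hb _ (by omega))
            simpa using this
        exact hr.trans (.single (.lt_end_two hp ha' (hb _ (by omega)) hb') rfl rfl)
      · obtain ⟨c, rfl⟩ : ∃ c, b = a + c := Nat.exists_eq_add_of_le h.le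
        obtain ⟨s, rfl⟩ : ∃ s, a = c + s := Nat.exists_eq_add_of_le (by omega)
        have h1 := Reach.iterate' (T := T) (w := w) (σ := σ) (τ := τ) (i := 0) (j := 0)
              (q := .s0) (r := .lt) (k := 1) (l := 2) c (by omega) (Or.inl rfl) fun m hm p hp =>
                .lt_two hp (ha _ (by omega)) (hb _ (by omega)) (hb _ (by omega))
        have h2 := Reach.iterate (T := T) (w := w) (σ := σ) (τ := τ) (i := 0 + 1 * c)
          (j := 0 + 2 * c) (p := .lt) (k := 1) (l := 1) s fun m hm =>
                .lt_one (ha _ (by omega)) (hb _ (by omega))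
        refine (h1.trans h2).trans (.single (.lt_end ?_ ?_) (by omega) (by omega))
        · rw [← ha']; congr 1; omega
        · rw [← hb']; congr 1; omega
    · by_cases heq : ∀ n ≤ a, τ n = σ n
      · by_contra hN
        obtain ⟨d, M, t, hg⟩ := exists_good_of_not_reach ha ha' fun hr =>
          hN (hr.congr (fun _ _ => rfl) fun n hn => (heq n (by omega)).symm)
        exact hno _ _ _ _ _ hg
      · push Not at heq
        obtain ⟨n, hn, hne⟩ := heq
        have hn : n < a := by
          rcases hn.lt_or_eq with h | rfl
          · exact h
          · exact absurd (hb'.trans ha'.symm) hne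
        have sink : ∀ m, ∀ i, i + m = a → Reach T w σ τ .sink i i .s0 (a + 1) (a + 1) := by
          intro m
          induction m with
          | zero =>
            rintro i rfl
            exact .single (.sink_end ha' hb') rfl rfl
          | succ m ih =>
            intro i hi
            exact (Reach.single (.sink_one (ha _ (by omega)) (hb _ (by omega))) rfl rfl).trans
              (ih (i + 1) (by omega))
        obtain ⟨p, hp, hr⟩ : ∃ p, (p = .s0 ∨ p = .scan) ∧ Reach T w σ τ .s0 0 0 p n n := by
          rcases Nat.eq_zero_or_pos n with rfl | h0
          · exact ⟨_, Or.inl rfl, .refl⟩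
          · refine ⟨_, Or.inr rfl, ?_⟩
            have := Reach.iterate' (T := T) (w := w) (σ := σ) (τ := τ) (i := 0) (j := 0)
              (q := .s0) (r := .scan) (k := 1) (l := 1) n h0 (Or.inl rfl) fun m hm p hp =>
                .scan_go hp (ha _ (by omega)) (hb _ (by omega))
            simpa using this
        exact (hr.trans (.single (.scan_ne hp (ha _ (by omega)) (hb _ (by omega)) hne.symm)
          rfl rfl)).trans (sink (a - (n + 1)) (n + 1) (by omega))
    · rcases Nat.lt_or_ge b (a - b) with h' | h'
      · obtain rfl : a = 2 * b + 1 := by omega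
        obtain ⟨p, hp, hr⟩ : ∃ p, (p = .s0 ∨ p = .gt) ∧ Reach T w σ τ .s0 0 0 p (2 * b) b := by
          rcases Nat.eq_zero_or_pos b with rfl | h0
          · exact ⟨_, Or.inl rfl, .refl⟩
          · refine ⟨_, Or.inr rfl, ?_⟩
            have := Reach.iterate' (T := T) (w := w) (σ := σ) (τ := τ) (i := 0) (j := 0)
              (q := .s0) (r := .gt) (k := 2) (l := 1) b h0 (Or.inl rfl) fun m hm p hp =>
                .gt_two hp (hb _ (by omega)) (ha _ (by omega)) (ha _ (by omega))
            simpa using this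
        exact hr.trans (.single (.gt_end_two hp hb' (ha _ (by omega)) ha') rfl rfl)
      · obtain ⟨c, rfl⟩ : ∃ c, a = b + c := Nat.exists_eq_add_of_le h.le
        obtain ⟨s, rfl⟩ : ∃ s, b = c + s := Nat.exists_eq_add_of_le (by omega)
        have h1 := Reach.iterate' (T := T) (w := w) (σ := σ) (τ := τ) (i := 0) (j := 0)
              (q := .s0) (r := .gt) (k := 2) (l := 1) c (by omega) (Or.inl rfl) fun m hm p hp =>
                .gt_two hp (hb _ (by omega)) (ha _ (by omega)) (ha _ (by omega))
        have h2 := Reach.iterate (T := T) (w := w) (σ := σ) (τ := τ) (i := 0 + 2 * c)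
          (j := 0 + 1 * c) (p := .gt) (k := 1) (l := 1) s fun m hm =>
                .gt_one (ha _ (by omega)) (hb _ (by omega))
        refine (h1.trans h2).trans (.single (.gt_end ?_ ?_) (by omega) (by omega))
        · rw [← ha']; congr 1; omega
        · rw [← hb']; congr 1; omega
  | @left a ha ha' hb =>
    obtain ⟨p, hp, hr⟩ : ∃ p, (p = .s0 ∨ p = .cb) ∧ Reach T w σ τ .s0 0 0 p a (2 * a) := by
      rcases Nat.eq_zero_or_pos a with rfl | h0
      · exact ⟨_, Or.inl rfl, .refl⟩
      · refine ⟨_, Or.inr rfl, ?_⟩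
        have := Reach.iterate' (T := T) (w := w) (σ := σ) (τ := τ) (i := 0) (j := 0)
          (q := .s0) (r := .cb) (k := 1) (l := 2) a h0 (Or.inl rfl) fun m hm p hp =>
            .cb_go hp (ha _ (by omega)) (hb _ (by omega)) (hb _ (by omega))
        simpa using this
    exact hr.trans (.single (.cb_end hp ha' (hb _ (by omega)) (hb _ (by omega))) rfl rfl)
  | @right b hb hb' ha =>
    obtain ⟨p, hp, hr⟩ : ∃ p, (p = .s0 ∨ p = .cc) ∧ Reach T w σ τ .s0 0 0 p (2 * b) b := by
      rcases Nat.eq_zero_or_pos b with rfl | h0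
      · exact ⟨_, Or.inl rfl, .refl⟩
      · refine ⟨_, Or.inr rfl, ?_⟩
        have := Reach.iterate' (T := T) (w := w) (σ := σ) (τ := τ) (i := 0) (j := 0)
          (q := .s0) (r := .cc) (k := 2) (l := 1) b h0 (Or.inl rfl) fun m hm p hp =>
            .cc_go hp (hb _ (by omega)) (ha _ (by omega)) (ha _ (by omega))
        simpa using this
    exact hr.trans (.single (.cc_end hp hb' (ha _ (by omega)) (ha _ (by omega))) rfl rfl)

/-- If there are no good words, the automaton can read any finite parts of the tapes. -/
theorem exists_reach_of_no_good
    (hno : ∀ (ρ : ℕ → A) (ℓ d M t : ℕ), ¬ Good T w ρ ℓ d M t) (N1 N2 : ℕ)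
    (hσ : ∀ n ≥ N1, σ n = T.hash) (hτ : ∀ n ≥ N2, τ n = T.hash) :
    ∃ i j, N1 ≤ i ∧ N2 ≤ j ∧ Reach T w σ τ .s0 0 0 .s0 i j := by
  obtain ⟨N, hN⟩ : ∃ N, N1 + N2 = N := ⟨_, rfl⟩
  induction N using Nat.strong_induction_on generalizing N1 N2 σ τ with
  | _ N ih =>
    by_cases h0 : N = 0
    · exact ⟨0, 0, by omega, by omega, .refl⟩
    obtain ⟨e1, e2, he⟩ := exists_tokEnd (T := T) ⟨N1, hσ _ le_rfl⟩ ⟨N2, hτ _ le_rfl⟩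
    have := he.pos
    obtain ⟨i, j, hi, hj, hr⟩ := ih (N1 - e1 + (N2 - e2)) (by omega)
      (σ := fun n => σ (e1 + n)) (τ := fun n => τ (e2 + n)) (N1 - e1) (N2 - e2)
      (fun n hn => hσ _ (by omega)) (fun n hn => hτ _ (by omega)) rfl
    exact ⟨e1 + i, e2 + j, by omega, by omega, (he.reach hno).trans hr.of_shift⟩

/-- If there is a good word, any finite parts of the tapes can be extended in such a way that the
automaton cannot read them beyond some point. -/
theorem exists_stuck_of_good {ρ : ℕ → A} {ℓ d M t : ℕ} (g : Good T w ρ ℓ d M t) (N1 N2 : ℕ)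
    (σ τ : ℕ → A) : ∃ (σ' τ' : ℕ → A) (K : ℕ), (∀ n < N1, σ' n = σ n) ∧ (∀ n < N2, τ' n = τ n) ∧
      ∀ σ'' τ'' : ℕ → A, (∀ n < K, σ'' n = σ' n) → (∀ n < K, τ'' n = τ' n) →
        ∀ r i j, K ≤ i → K ≤ j → ¬ Reach T w σ'' τ'' .s0 0 0 r i j := by
  obtain ⟨N, hN⟩ : ∃ N, N1 + N2 = N := ⟨_, rfl⟩
  induction N using Nat.strong_induction_on generalizing N1 N2 σ τ with
  | _ N ih =>
    by_cases h0 : N = 0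
    · refine ⟨ρ, ρ, ℓ + 1, by omega, by omega, fun σ'' τ'' hσ hτ r i j hi hj hr => ?_⟩
      have := (g.congr fun n hn => hσ n (by omega)).le_of_reach
        (fun n hn => (hτ n (by omega)).trans (hσ n (by omega)).symm) hr
      omega
    obtain ⟨e1, e2, he⟩ := exists_tokEnd (T := T) (σ := fun n => if n < N1 then σ n else T.hash)
      (τ := fun n => if n < N2 then τ n else T.hash) ⟨N1, by simp⟩ ⟨N2, by simp⟩
    have hpos := he.pos
    obtain ⟨σ', τ', K, hσ', hτ', h⟩ := ih (N1 - e1 + (N2 - e2)) (by omega) (N1 - e1) (N2 - e2)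
      (fun n => σ (e1 + n)) (fun n => τ (e2 + n)) rfl
    refine ⟨fun n => if n < e1 then (if n < N1 then σ n else T.hash) else σ' (n - e1),
      fun n => if n < e2 then (if n < N2 then τ n else T.hash) else τ' (n - e2),
      e1 + e2 + K, ?_, ?_, ?_⟩
    · intro n hn
      by_cases h : n < e1
      · simp [h, hn]
      · simp only [h, if_false]
        rw [hσ' _ (by omega)]
        congr 1; omega
    · intro n hn
      by_cases h : n < e2
      · simp [h, hn]
      · simp only [h, if_false]
        rw [hτ' _ (by omega)]
        congr 1; omega
    · intro σ'' τ'' hσ hτ r i j hi hj hr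
      have he' : TokEnd T σ'' τ'' e1 e2 := he.congr
        (fun n hn => by rw [hσ n (by omega)]; simp [hn])
        (fun n hn => by rw [hτ n (by omega)]; simp [hn])
      rcases he'.lt_or_reach hr with h' | h' | h'
      · omega
      · omega
      · obtain ⟨i', j', rfl, rfl, h''⟩ := h'.shift (a := e1) (b := e2) (i := 0) (j := 0)
        refine h _ _ ?_ ?_ r i' j' (by omega) (by omega) h''
        · intro n hn
          rw [hσ _ (by omega)]
          simp
        · intro n hn
          rw [hτ _ (by omega)]
          simp

end DiagGifs

namespace DiagGifs
open Turing

/-- A machine supported on a finite set of states may be restricted to it. -/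
theorem exists_finite_machine {Γ Λ : Type} [Inhabited Γ] [Inhabited Λ] (M : TM0.Machine Γ Λ)
    (S : Finset Λ) (ss : TM0.Supports M ↑S) :
    ∃ (Q : Type) (_ : Inhabited Q) (_ : Finite Q) (M' : TM0.Machine Γ Q), ∀ l : List Γ,
      (StateTransition.eval (TM0.step M') (TM0.init l)).Dom ↔
        (StateTransition.eval (TM0.step M) (TM0.init l)).Dom := by
  classical
  let iQ : Inhabited {q // q ∈ S} := ⟨⟨default, ss.1⟩⟩
  let g₁ : PointedMap Λ {q // q ∈ S} :=
    ⟨fun q => if h : q ∈ S then ⟨q, h⟩ else default, by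
      have : (default : Λ) ∈ S := ss.1
      simp only [this, dif_pos]; rfl⟩
  let f : PointedMap Γ Γ := ⟨id, rfl⟩
  refine ⟨{q // q ∈ S}, iQ, inferInstance, M.map f f g₁ Subtype.val, fun l => ?_⟩
  have hr := TM0.Machine.map_respects M f f g₁ Subtype.val ss (fun _ => rfl) (by
    intro q hq
    have : q ∈ S := hq
    change (Subtype.val (if h : q ∈ S then (⟨q, h⟩ : {q // q ∈ S}) else default)) = q
    rw [dif_pos this])
  refine StateTransition.tr_eval_dom hr ⟨ss.1, ?_⟩
  rw [TM0.map_init]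
  congr 1
  exact List.map_id l

theorem trNat_eq (n : ℕ) : PartrecToTM2.trNat n = if n = 0 then [] else
    (if n % 2 = 1 then PartrecToTM2.Γ'.bit1 else PartrecToTM2.Γ'.bit0) ::
      PartrecToTM2.trNat (n / 2) := by
  have key : ∀ p : PosNum, PartrecToTM2.trNat (p : ℕ) = PartrecToTM2.trPosNum p := by
    intro p
    rw [PartrecToTM2.trNat, PosNum.of_to_nat]
    rfl
  rcases Nat.eq_zero_or_pos n with rfl | hn
  · simp
  obtain ⟨p, rfl⟩ : ∃ p : PosNum, (p : ℕ) = n := by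
    have h : ((n : Num) : ℕ) = n := Num.to_of_nat n
    rcases hc : (n : Num) with _ | p
    · rw [hc] at h
      have : ((Num.zero : Num) : ℕ) = 0 := rfl
      omega
    · exact ⟨p, by rw [hc] at h; exact h⟩
  rw [if_neg hn.ne', key]
  cases p with
  | one => simp [PartrecToTM2.trPosNum]
  | bit0 p =>
    have : ((PosNum.bit0 p : PosNum) : ℕ) = (p : ℕ) + p := rfl
    rw [if_neg (by omega), show ((PosNum.bit0 p : PosNum) : ℕ) / 2 = p by omega, key]
    rfl
  | bit1 p =>
    have : ((PosNum.bit1 p : PosNum) : ℕ) = (p : ℕ) + p + 1 := rfl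
    rw [if_pos (by omega), show ((PosNum.bit1 p : PosNum) : ℕ) / 2 = p by omega, key]
    rfl

open PartrecToTM2 in
theorem primrec_map_trNat {β : Type} [Primcodable β] (g : Γ' → β) :
    Primrec fun n => (trNat n).map g := by
  have : Primrec₂ fun (_ : Unit) (n : ℕ) => (trNat n).map g := by
    refine Primrec.nat_strong_rec _ (g := fun _ l => if l.length = 0 then some [] else
      (l[l.length / 2]?).map (fun l' => (if l.length % 2 = 1 then g .bit1 else g .bit0) :: l'))
      ?_ ?_
    · refine Primrec.ite (Primrec.eq.comp (Primrec.list_length.comp Primrec.snd)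
        (Primrec.const 0)) (Primrec.const _) ?_
      refine Primrec.option_map (Primrec.list_getElem?.comp Primrec.snd
        (Primrec.nat_div2.comp (Primrec.list_length.comp Primrec.snd)) |>.of_eq fun a => by
          rw [Nat.div2_val]) ?_
      refine Primrec.list_cons.comp (Primrec.ite (Primrec.eq.comp (Primrec.nat_mod.comp
        (Primrec.list_length.comp (Primrec.snd.comp Primrec.fst)) (Primrec.const 2))
        (Primrec.const 1)) (Primrec.const _) (Primrec.const _)) Primrec.snd
    · intro _ n
      rw [trNat_eq n]
      by_cases hn : n = 0
      · simp [hn]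
      · have : n / 2 < n := by omega
        simp only [List.length_map, List.length_range, if_neg hn, List.getElem?_map,
          List.getElem?_range this, Option.map_some, List.map_cons]
        split_ifs <;> rfl
  exact this.comp (Primrec.const ()) Primrec.id

theorem dom_eval_translate {K : Type} [DecidableEq K] {Γ : K → Type} {Λ σ : Type} [Inhabited Λ]
    [Inhabited σ] (M : Λ → TM2.Stmt Γ Λ σ) (k : K) (L : List (Γ k)) :
    (StateTransition.eval (TM0.step (TM1to0.tr (TM2to1.tr M)))
      (TM0.init (TM2to1.trInit k L))).Dom ↔
      (StateTransition.eval (TM2.step M) (TM2.init k L)).Dom := by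
  have h := TM2to1.tr_eval_dom M k L
  rw [← TM1to0.tr_eval] at h
  exact h

open PartrecToTM2 in
/-- There is a Turing machine with an undecidable halting problem. -/
theorem exists_undecidable_machine : ∃ (Γ Q : Type) (_ : Inhabited Γ) (_ : Finite Γ)
    (_ : Inhabited Q) (_ : Finite Q) (M : TM0.Machine Γ Q) (w : ℕ → List Γ),
    (∀ n, w n ≠ []) ∧
    (∀ (β : Type) [Primcodable β] (g : Γ → β), Primrec fun n => (w n).map g) ∧
    ¬ ComputablePred fun n => (StateTransition.eval (TM0.step M) (TM0.init (w n))).Dom := by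
  classical
  have hf : Partrec fun n : ℕ => (Denumerable.ofNat Nat.Partrec.Code n).eval 0 :=
    Nat.Partrec.Code.eval_part.comp (Computable.ofNat _) (Computable.const 0)
  obtain ⟨c, hc⟩ := ToPartrec.Code.exists_code (Nat.Partrec'.part_iff₁.2 hf)
  let iΛ : Inhabited PartrecToTM2.Λ' := ⟨trNormal c Cont'.halt⟩
  have ss := TM2to1.tr_supports _ (PartrecToTM2.tr_supports c Cont'.halt)
  obtain ⟨Q, iQ, fQ, M, hM⟩ := exists_finite_machine _ _ (TM1to0.tr_supports _ ss)
  let fK : Fintype K' := ⟨{.main, .rev, .aux, .stack}, fun k => by cases k <;> simp⟩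
  refine ⟨TM2to1.Γ' K' fun _ => Γ', Q, inferInstance, inferInstance, iQ, fQ, M,
    fun n => TM2to1.trInit K'.main (trList [n]), ?_, ?_, ?_⟩
  · intro n
    exact List.cons_ne_nil _ _
  · intro β _ g
    have h : Primrec fun n => g (true, Function.update (fun _ => none) K'.main (some Γ'.cons)) ::
        ((trNat n).map fun a =>
          g (false, Function.update (fun _ => none) K'.main (some a))).reverse :=
      Primrec.list_cons.comp (Primrec.const _)
        (Primrec.list_reverse.comp (primrec_map_trNat _))
    refine h.of_eq fun n => ?_
    have hrev : (trList [n]).reverse = Γ'.cons :: (trNat n).reverse := by simp [trList]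
    beta_reduce
    rw [TM2to1.trInit, hrev]
    change _ = g _ :: List.map g (List.map _ _)
    rw [← List.map_reverse]
    exact congrArg _ (List.map_map (f := fun a => (false, _)) (g := g) (l := _)).symm
  · intro h
    refine ComputablePred.halting_problem 0 (ComputablePred.computable_of_manyOneReducible
      (q := _) ⟨Encodable.encode, Computable.encode, fun d => ?_⟩ h)
    refine Iff.trans ?_ ((hM _).trans (dom_eval_translate _ _ _)).symm
    have h2 : TM2.init K'.main (trList [Encodable.encode d]) =
        PartrecToTM2.init c [Encodable.encode d] := by
      rw [TM2.init, PartrecToTM2.init]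
      congr 1
      funext k
      cases k <;> simp [K'.elim]
    rw [h2, PartrecToTM2.tr_eval]
    have h3 := hc ⟨[Encodable.encode d], rfl⟩
    simp only at h3
    rw [h3]
    simp [List.Vector.head]

end DiagGifs

namespace DiagGifs
open Turing StateTransition

/-- A cell of a tape: a symbol, together with the state of the machine if the head is there. -/
abbrev Cell (Γ Q : Type) : Type := Γ × Option Q

section Cells

variable {Γ Q : Type} [Inhabited Γ] [Inhabited Q] (M : Q → Γ → Option (Q × TM0.Stmt Γ))

/-- The blank cell. -/
def blank : Cell Γ Q := (default, none)

/-- The machine stops when its head is at this cell. -/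
def IsHalting (x : Cell Γ Q) : Prop := ∃ q, x.2 = some q ∧ M q x.1 = none

/-- The state in which the head leaves the cell to the right, if it does. -/
def moveRight (x : Cell Γ Q) : Option Q :=
  match x.2 with
  | some q =>
    match M q x.1 with
    | some (q', .move .right) => some q'
    | _ => none
  | none => none

/-- The state in which the head leaves the cell to the left, if it does. -/
def moveLeft (x : Cell Γ Q) : Option Q :=
  match x.2 with
  | some q =>
    match M q x.1 with
    | some (q', .move .left) => some q'
    | _ => none
  | none => none

/-- The next contents of the cell `c` between the cells `l` and `r`. -/
def stepCell (l c r : Cell Γ Q) : Cell Γ Q :=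
  match c.2 with
  | some q =>
    match M q c.1 with
    | some (q', .write b) => (b, some q')
    | some (_, .move _) => (c.1, none)
    | none => c
  | none => (c.1, (moveRight M l).or (moveLeft M r))

/-- The cells of the tape of a configuration, with the head in column `h`. -/
noncomputable def cells (c : TM0.Cfg Γ Q) (h j : ℤ) : Cell Γ Q :=
  (c.Tape.nth (j - h), if j = h then some c.q else none)

/-- The rows of the space time diagram on input `l`, each shifted by one with respect to the
previous one. -/
noncomputable def row (l : List Γ) : ℕ → ℤ → Cell Γ Q
  | 0, j => cells (TM0.init l) 1 j
  | k + 1, j => stepCell M (row l k (j - 2)) (row l k (j - 1)) (row l k j)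

variable {M}

theorem exists_cells_step {c c' : TM0.Cfg Γ Q}
    (hc : TM0.step (M : TM0.Machine Γ Q) c = some c') (h : ℤ) :
    ∃ h', ∀ j, stepCell M (cells c h (j - 2)) (cells c h (j - 1)) (cells c h j) =
      cells c' h' j := by
  obtain ⟨q, T⟩ := c
  obtain ⟨⟨q', s⟩, hs, rfl⟩ := Option.map_eq_some_iff.1 hc
  change M q T.head = some (q', s) at hs
  have key : ∀ j, j = h + 1 ∨ j = h + 2 ∨ j = h ∨ (j - 1 ≠ h ∧ j - 2 ≠ h ∧ j ≠ h) := by omega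
  have e2 : h + 2 - 1 = h + 1 := by omega
  have e4 : h + 1 - (h + 2) = -1 := by omega
  rcases s with (_ | _) | b
  · refine ⟨h, fun j => ?_⟩
    rcases key j with rfl | rfl | rfl | ⟨h1, h2, h3⟩
    · simp [stepCell, cells, hs]
    · simp [stepCell, cells, moveRight, moveLeft, hs, e2]
    · simp [stepCell, cells, moveRight, moveLeft, hs]
      rw [← Tape.nth_zero, Tape.move_left_nth]
      rfl
    · simp [stepCell, cells, moveRight, moveLeft, h1, h2, h3]
      congr 1; ring
  · refine ⟨h + 2, fun j => ?_⟩
    rcases key j with rfl | rfl | rfl | ⟨h1, h2, h3⟩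
    · simp [stepCell, cells, hs, e4]
    · simp [stepCell, cells, moveRight, moveLeft, hs, e2]
      exact (Tape.move_right_nth T 0).symm
    · simp [stepCell, cells, moveRight, moveLeft, hs]
    · have h2' : j ≠ h + 2 := by omega
      simp [stepCell, cells, moveRight, moveLeft, h1, h2, h3, h2']
      congr 1; ring
  · refine ⟨h + 1, fun j => ?_⟩
    rcases key j with rfl | rfl | rfl | ⟨h1, h2, h3⟩
    · simp [stepCell, cells, hs]
      rfl
    · simp [stepCell, cells, moveRight, moveLeft, hs, e2]
    · simp [stepCell, cells, moveRight, moveLeft, hs]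
    · have h2' : j ≠ h + 1 := by omega
      have h2'' : j - (h + 1) ≠ 0 := by omega
      simp [stepCell, cells, moveRight, moveLeft, h1, h2, h3, h2', h2'']
      congr 1; ring

theorem row_of_nonpos (l : List Γ) (k : ℕ) {j : ℤ} (hj : j ≤ 0) : row M l k j = blank := by
  induction k generalizing j with
  | zero =>
    obtain ⟨n, rfl⟩ : ∃ n : ℕ, j = -n := ⟨j.natAbs, by omega⟩
    have h1 : -(n : ℤ) - 1 = -(n + 1 : ℕ) := by push_cast; ring
    have h2 : -(n : ℤ) ≠ 1 := by omega
    simp only [row, cells, blank, TM0.init, h1, h2, if_false]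
    rfl
  | succ k ih =>
    rw [row, ih (by omega), ih (by omega), ih hj]
    rfl

theorem row_zero_succ (l : List Γ) (i : ℕ) :
    row M l 0 (i + 1) = (l.getI i, if i = 0 then some default else none) := by
  simp only [row, cells, TM0.init, add_sub_cancel_right, Tape.mk₁, Tape.mk₂, Tape.mk'_nth_nat,
    ListBlank.nth_mk]
  congr 1
  split_ifs <;> first | rfl | omega

theorem IsHalting.row_succ {l : List Γ} {k : ℕ} {j : ℤ} (h : IsHalting M (row M l k j)) :
    IsHalting M (row M l (k + 1) (j + 1)) := by
  obtain ⟨q, hq, hM⟩ := h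
  rw [row, add_sub_cancel_right]
  simp only [stepCell, hq, hM]
  exact ⟨q, hq, hM⟩

/-- The machine halts if and only if its space time diagram contains a halting cell. -/
theorem dom_eval_iff (l : List Γ) :
    (eval (TM0.step (M : TM0.Machine Γ Q)) (TM0.init l)).Dom ↔
      ∃ k j, IsHalting M (row M l k j) := by
  have halt_iff : ∀ c : TM0.Cfg Γ Q, TM0.step (M : TM0.Machine Γ Q) c = none ↔
      M c.q c.Tape.head = none := fun c => Option.map_eq_none_iff
  constructor
  · intro h
    obtain ⟨hr, hc⟩ := mem_eval.1 (Part.get_mem h)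
    generalize (eval (TM0.step (M : TM0.Machine Γ Q)) (TM0.init l)).get h = c at hr hc
    have : ∃ k h, ∀ j, row M l k j = cells c h j := by
      clear hc
      induction hr with
      | refl => exact ⟨0, 1, fun j => rfl⟩
      | tail _ hs ih =>
        obtain ⟨k, h, hk⟩ := ih
        obtain ⟨h', hh⟩ := exists_cells_step hs h
        exact ⟨k + 1, h', fun j => by rw [row, hk, hk, hk, hh]⟩
    obtain ⟨k, h, hk⟩ := this
    refine ⟨k, h, c.q, ?_, ?_⟩
    · simp [hk, cells]
    · simpa [hk, cells] using (halt_iff c).1 hc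
  · rintro ⟨k, j, hj⟩
    have : ∀ k, (eval (TM0.step (M : TM0.Machine Γ Q)) (TM0.init l)).Dom ∨
        ∃ c h, Reaches (TM0.step (M : TM0.Machine Γ Q)) (TM0.init l) c ∧
          ∀ j, row M l k j = cells c h j := by
      intro k
      induction k with
      | zero => exact .inr ⟨_, 1, .refl, fun j => rfl⟩
      | succ k ih =>
        rcases ih with ih | ⟨c, h, hr, hk⟩
        · exact .inl ih
        rcases hs : TM0.step (M : TM0.Machine Γ Q) c with _ | c'
        · exact .inl (Part.dom_iff_mem.2 ⟨c, mem_eval.2 ⟨hr, hs⟩⟩)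
        · obtain ⟨h', hh⟩ := exists_cells_step hs h
          exact .inr ⟨c', h', hr.tail hs, fun j => by rw [row, hk, hk, hk, hh]⟩
    rcases this k with h | ⟨c, h, hr, hk⟩
    · exact h
    obtain ⟨q, hq, hM⟩ := hj
    rw [hk] at hq hM
    by_cases hjh : j = h
    · subst hjh
      simp only [cells, if_true, Option.some.injEq, sub_self] at hq hM
      subst hq
      exact Part.dom_iff_mem.2 ⟨c, mem_eval.2 ⟨hr, (halt_iff c).2 hM⟩⟩
    · simp [cells, hjh] at hq

end Cells
end DiagGifs

namespace DiagGifs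
open Turing StateTransition

/-- The letters used to write down space time diagrams. -/
inductive Letter (Γ Q : Type)
  | hash | Z | Y | W | E
  | cell (x : Cell Γ Q)

instance {Γ Q : Type} [Finite Γ] [Finite Q] : Finite (Letter Γ Q) := by
  refine Finite.of_surjective (α := Fin 5 ⊕ Cell Γ Q)
    (Sum.elim ![.hash, .Z, .Y, .W, .E] .cell) fun x => ?_
  cases x with
  | hash => exact ⟨.inl 0, rfl⟩
  | Z => exact ⟨.inl 1, rfl⟩
  | Y => exact ⟨.inl 2, rfl⟩
  | W => exact ⟨.inl 3, rfl⟩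
  | E => exact ⟨.inl 4, rfl⟩
  | cell x => exact ⟨.inr x, rfl⟩

section Diagrams

variable {Γ Q : Type} [Inhabited Γ] [Inhabited Q] (M : Q → Γ → Option (Q × TM0.Stmt Γ))
  {A : Type} {enc : Letter Γ Q → A} {dec : A → Letter Γ Q} (hdec : Function.LeftInverse dec enc)

/-- The letters which mark the beginning of a row. -/
def Letter.IsWall : Letter Γ Q → Prop
  | .Y => True
  | .W => True
  | _ => False

/-- The cell described by a letter. -/
def Letter.toCell : Letter Γ Q → Cell Γ Q
  | .cell x => x
  | _ => blank

open scoped Classical in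
/-- The letter below `r`, where `l`, `c`, `r` are consecutive letters of a diagram. -/
noncomputable def nextLetter (l c r : Letter Γ Q) : Letter Γ Q :=
  if r.IsWall then .W
  else if c.IsWall then .cell (stepCell M blank blank r.toCell)
  else .cell (stepCell M l.toCell c.toCell r.toCell)

/-- The alphabet data describing the diagrams of a machine. -/
noncomputable def machineRules : Rules A where
  hash := enc .hash
  Z := enc .Z
  Y := enc .Y
  W := enc .W
  E := enc .E
  B := enc (.cell blank)
  H x := ∃ c, x = enc (.cell c) ∧ IsHalting M c
  F l c r := enc (nextLetter M (dec l) (dec c) (dec r))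
  Z_ne_hash h := nomatch hdec.injective h
  Y_ne_hash h := nomatch hdec.injective h
  E_ne_hash h := nomatch hdec.injective h
  B_ne_hash h := nomatch hdec.injective h
  Z_ne_Y h := nomatch hdec.injective h
  Z_ne_E h := nomatch hdec.injective h
  Y_ne_E h := nomatch hdec.injective h
  B_ne_W h := nomatch hdec.injective h
  W_ne_E h := nomatch hdec.injective h
  not_H_W := fun ⟨_, h, _⟩ => nomatch hdec.injective h

/-- The letters following the first `Y` in a diagram for the input `l`. -/
def inputWord (enc : Letter Γ Q → A) (l : List Γ) : List A :=
  enc .Y :: enc .Y :: enc (.cell (l.headI, some default)) ::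
    l.tail.map fun a => enc (.cell (a, none))

theorem length_inputWord {l : List Γ} (hl : l ≠ []) :
    (inputWord enc l).length = l.length + 2 := by
  cases l with
  | nil => exact absurd rfl hl
  | cons a l => simp [inputWord]

theorem inputWord_getElem? {l : List Γ} (hl : l ≠ []) {i : ℕ} (hi : i < l.length) :
    (inputWord enc l)[i + 2]? = some (enc (.cell (row M l 0 (i + 1)))) := by
  cases l with
  | nil => exact absurd rfl hl
  | cons a l =>
    rw [row_zero_succ]
    cases i with
    | zero => simp [inputWord]
    | succ i =>
      have hi' : i < l.length := by simpa using hi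
      simp [inputWord, List.getElem?_eq_getElem hi', List.getI_eq_getElem?_getD]

theorem row_zero_of_le (l : List Γ) (hl : l ≠ []) {i : ℕ} (hi : l.length ≤ i) :
    row M l 0 (i + 1) = blank := by
  have h0 : 0 < l.length := List.length_pos_iff.2 hl
  rw [row_zero_succ, if_neg (by omega)]
  simp [List.getI_eq_getElem?_getD, List.getElem?_eq_none hi, blank]

/-- The letter in column `c` of row `k` of the diagram. -/
noncomputable def diagramLetter (l : List Γ) (k c : ℕ) : Letter Γ Q :=
  if c = 0 then .W else .cell (row M l k c)

variable {M}

/-- In terms of the letters above. -/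
theorem nextLetter_diagramLetter (l : List Γ) (k c : ℕ) (x y z : Letter Γ Q)
    (hz : z.IsWall ↔ c = 0) (hz' : c ≠ 0 → z = .cell (row M l k c))
    (hy : c ≠ 0 → (y.IsWall ↔ c = 1)) (hy' : 2 ≤ c → y = .cell (row M l k (c - 1 : ℕ)))
    (hx : 2 ≤ c → x.toCell = row M l k (c - 2 : ℕ)) :
    nextLetter M x y z = diagramLetter M l (k + 1) c := by
  unfold nextLetter diagramLetter
  by_cases h0 : c = 0
  · rw [if_pos (hz.2 h0), if_pos h0]
  rw [if_neg (mt hz.1 h0), if_neg h0, hz' h0, row]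
  by_cases h1 : c = 1
  · subst h1
    rw [if_pos ((hy h0).2 rfl), row_of_nonpos (j := ((1 : ℕ) : ℤ) - 2) _ _ (by norm_num),
      row_of_nonpos (j := ((1 : ℕ) : ℤ) - 1) _ _ (by norm_num)]
    rfl
  · rw [if_neg (mt (hy h0).1 h1), hx (by omega), hy' (by omega), Nat.cast_sub (by omega),
      Nat.cast_sub (by omega)]
    rfl

end Diagrams
end DiagGifs

namespace DiagGifs
open Turing StateTransition

section Diagrams

theorem Letter.IsWall.toCell_eq {Γ Q : Type} [Inhabited Γ] {z : Letter Γ Q} (h : z.IsWall) :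
    z.toCell = blank := by
  cases z <;> first | rfl | exact h.elim

variable {Γ Q : Type} [Inhabited Γ] [Inhabited Q] {M : Q → Γ → Option (Q × TM0.Stmt Γ)}
  {A : Type} {enc : Letter Γ Q → A} {dec : A → Letter Γ Q} {hdec : Function.LeftInverse dec enc}

theorem not_isHalting_blank : ¬ IsHalting M blank := by
  simp [IsHalting, blank]

variable {l : List Γ} {σ : ℕ → A} {ℓ d N t : ℕ}

theorem rules_eq_diagramLetter {d : ℕ} (hd0 : 0 < d) (m : ℕ)
    (ih : ∀ m' ≤ m, ∃ z, σ (d + 2 + m') = enc z ∧ (z.IsWall ↔ m' % d = 0) ∧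
      (m' % d ≠ 0 → z = .cell (row M l (m' / d) (m' % d : ℕ)))) :
    (machineRules M hdec).F (σ (m + d)) (σ (m + d + 1)) (σ (m + d + 2)) =
      enc (diagramLetter M l ((m + d) / d) ((m + d) % d)) := by
  have hmk := Nat.div_add_mod m d
  have hc : m % d < d := Nat.mod_lt _ hd0
  have hmod (i : ℕ) (hi : i ≤ m % d) : (m - i) % d = m % d - i := by
    rw [show m - i = (m % d - i) + d * (m / d) by omega, Nat.add_mul_mod_self_left,
      Nat.mod_eq_of_lt (by omega)]
  have hdiv (i : ℕ) (hi : i ≤ m % d) : (m - i) / d = m / d := by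
    rw [show m - i = (m % d - i) + d * (m / d) by omega, Nat.add_mul_div_left _ _ hd0,
      Nat.div_eq_of_lt (by omega), zero_add]
  obtain ⟨z, hz, hzw, hzc⟩ := ih m le_rfl
  rw [Nat.add_mod_right, Nat.add_div_right _ hd0, show m + d + 2 = d + 2 + m by omega, hz]
  refine congrArg enc (((congrArg _ (hdec z)).trans ?_))
  refine nextLetter_diagramLetter l (m / d) (m % d) _ _ z hzw hzc ?_ ?_ ?_
  · intro h
    obtain ⟨y, hy, hyw, -⟩ := ih (m - 1) (by omega)
    rw [show m + d + 1 = d + 2 + (m - 1) by omega, hy, hdec, hyw, hmod 1 (by omega)]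
    omega
  · intro h
    obtain ⟨y, hy, -, hyc⟩ := ih (m - 1) (by omega)
    rw [hmod 1 (by omega), hdiv 1 (by omega)] at hyc
    rw [show m + d + 1 = d + 2 + (m - 1) by omega, hy, hdec, hyc (by omega)]
  · intro h
    obtain ⟨y, hy, hyw, hyc⟩ := ih (m - 2) (by omega)
    rw [hmod 2 (by omega)] at hyw hyc
    rw [hdiv 2 (by omega)] at hyc
    rw [show m + d = d + 2 + (m - 2) by omega, hy, hdec]
    by_cases h3 : m % d = 2
    · rw [(hyw.2 (by omega)).toCell_eq, h3, row_of_nonpos _ _ (by norm_num)]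
    · rw [hyc (by omega), Letter.toCell]

/-- The first row starts with three letters `Y`, and the second one with the first `W`. -/
theorem Good.width (hl : l ≠ [])
    (g : Good (machineRules M hdec) (inputWord enc l) σ ℓ d N t) :
    σ (d + 1) = enc .Y ∧ σ (d + 2) = enc .Y ∧ d = l.length + t + 1 ∧
    2 * d + 2 < N := by
  have h1 : σ (d + 1) = enc .Y := g.eq_w 0 _ rfl
  have h2 : σ (d + 2) = enc .Y := g.eq_w 1 _ rfl
  have hW := g.eq_W
  have hlt := g.W_lt
  rw [length_inputWord hl] at hW hlt
  have hp : 2 * d + 2 ≤ d + 1 + (l.length + 2) + t := by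
    by_contra hlt'
    exact g.ne_W _ (by omega) hlt hW
  have hN : 2 * d + 2 < N := by
    by_contra hle
    exact (machineRules M hdec).W_ne_E (hW.symm.trans (g.eq_E _ (by omega) hlt))
  have hr := g.rule d le_rfl (by omega)
  have hr' : σ (d + d + 2) = enc .W := by
    rw [hr, h1, h2]
    change enc (nextLetter M _ _ (dec (enc .Y))) = _
    rw [hdec, nextLetter, if_pos (show Letter.IsWall .Y from trivial)]
  refine ⟨h1, h2, ?_, hN⟩
  by_contra hne
  by_cases hd : d + d + 2 < d + 3 + l.length
  · obtain ⟨i, hi⟩ : ∃ i, d + d + 2 = d + 1 + (i + 2) :=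
      ⟨d - 1, by have := g.d_pos; omega⟩
    rw [hi, g.eq_w _ _ (inputWord_getElem? M hl (by omega))] at hr'
    exact nomatch hdec.injective hr'
  · obtain ⟨i, hi⟩ : ∃ i, d + d + 2 = d + 1 + (l.length + 2) + i :=
      ⟨d - 1 - l.length, by omega⟩
    have := g.eq_B i (by omega)
    rw [length_inputWord hl, ← hi, hr'] at this
    exact nomatch hdec.injective this

theorem Good.eq_row (hl : l ≠ [])
    (g : Good (machineRules M hdec) (inputWord enc l) σ ℓ d N t)
    (m : ℕ) (hm : d + 2 + m < N) : ∃ z, σ (d + 2 + m) = enc z ∧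
    (z.IsWall ↔ m % d = 0) ∧ (m % d ≠ 0 → z = .cell (row M l (m / d) (m % d : ℕ))) := by
  obtain ⟨h1, h2, hd, hN⟩ := g.width hl
  induction m using Nat.strong_induction_on with
  | _ m ih =>
    by_cases hmd : m < d
    · rw [Nat.mod_eq_of_lt hmd, Nat.div_eq_of_lt hmd]
      rcases m with _ | i
      · exact ⟨_, h2, by simp [Letter.IsWall], by simp⟩
      refine ⟨.cell (row M l 0 (i + 1)), ?_, by simp [Letter.IsWall], by simp⟩
      by_cases hi : i < l.length
      · exact (congrArg σ (by omega)).trans (g.eq_w _ _ (inputWord_getElem? M hl hi))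
      · rw [row_zero_of_le M l hl (by omega)]
        have := g.eq_B (i - l.length) (by omega)
        rw [length_inputWord hl] at this
        exact (congrArg σ (by omega)).trans this
    · obtain ⟨m, rfl⟩ := Nat.exists_eq_add_of_le' (not_lt.1 hmd)
      refine ⟨diagramLetter M l ((m + d) / d) ((m + d) % d), ?_, ?_, ?_⟩
      · rw [← rules_eq_diagramLetter (hdec := hdec) g.d_pos m
          fun m' hm' => ih m' (by have := g.d_pos; omega) (by omega)]
        exact (congrArg σ (by omega)).trans (g.rule (m + d) (by omega) (by omega))
      · unfold diagramLetter
        split_ifs with h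
        · exact iff_of_true trivial h
        · exact iff_of_false id h
      · intro h
        rw [diagramLetter, if_neg h]

theorem Good.exists_isHalting (hl : l ≠ [])
    (g : Good (machineRules M hdec) (inputWord enc l) σ ℓ d N t) :
    ∃ k j, IsHalting M (row M l k j) := by
  obtain ⟨-, -, -, hN⟩ := g.width hl
  obtain ⟨z, hz, hzw, hzc⟩ := g.eq_row hl (N - 1 - (d + 2)) (by omega)
  rw [show d + 2 + (N - 1 - (d + 2)) = N - 1 by omega] at hz
  have hN' := g.M_lt
  have hb := g.not_bad (N - 1) (by omega)
  rw [Nat.sub_add_cancel (by omega), g.eq_E N le_rfl hN'] at hb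
  have hH : (machineRules M hdec).H (σ (N - 1)) := by
    by_contra h
    exact hb (.inl ⟨rfl, h, g.ne_E _ (by omega)⟩)
  obtain ⟨c, hc, hc'⟩ := hH
  obtain rfl := hdec.injective (hz.symm.trans hc)
  have h0 : (N - 1 - (d + 2)) % d ≠ 0 := fun h => hzw.2 h
  exact ⟨_, _, Letter.cell.inj (hzc h0) ▸ hc'⟩

variable (M) in
open scoped Classical in
/-- A diagram with rows of width `d`, ending after `m` letters. -/
noncomputable def diagram (enc : Letter Γ Q → A) (l : List Γ) (d m n : ℕ) : A :=
  if n < d then enc .Z else if n < d + 3 then enc .Y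
  else if n < d + 3 + m then
    enc (diagramLetter M l ((n - (d + 2)) / d) ((n - (d + 2)) % d))
  else if n < 3 * (d + 3 + m) then enc .E else enc .hash

theorem diagram_eq_Y {d m n : ℕ} (h : d ≤ n) (h' : n < d + 3) :
    diagram M enc l d m n = enc .Y := by
  rw [diagram, if_neg (by omega), if_pos h']

theorem diagram_eq_row {d m n : ℕ} (h : n ≤ m) :
    ∃ z, diagram M enc l d m (d + 2 + n) = enc z ∧ (z.IsWall ↔ n % d = 0) ∧
      (n % d ≠ 0 → z = .cell (row M l (n / d) (n % d : ℕ))) := by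
  rcases n with _ | n
  · exact ⟨_, diagram_eq_Y (by omega) (by omega), by simp [Letter.IsWall], by simp⟩
  · refine ⟨_, by rw [diagram, if_neg (by omega), if_neg (by omega), if_pos (by omega),
      Nat.add_sub_cancel_left], ?_, fun h => by rw [diagramLetter, if_neg h]⟩
    unfold diagramLetter
    split_ifs with h
    · exact iff_of_true trivial h
    · exact iff_of_false id h

theorem diagram_eq_diagramLetter {d m n : ℕ} (h : n ≤ m) (h0 : n ≠ 0) :
    diagram M enc l d m (d + 2 + n) = enc (diagramLetter M l (n / d) (n % d)) := by
  rw [diagram, if_neg (by omega), if_neg (by omega), if_pos (by omega),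
      Nat.add_sub_cancel_left]

theorem diagram_eq_cell {d m n : ℕ} (h : n ≤ m) (h0 : n ≠ 0) (hd : n < d) :
    diagram M enc l d m (d + 2 + n) = enc (.cell (row M l 0 n)) := by
  rw [diagram_eq_diagramLetter h h0, diagramLetter, Nat.mod_eq_of_lt hd, if_neg h0,
    Nat.div_eq_of_lt hd]

theorem diagram_eq_E {d m n : ℕ} (h : d + 3 + m ≤ n) (h' : n < 3 * (d + 3 + m)) :
    diagram M enc l d m n = enc .E := by
  rw [diagram, if_neg (by omega), if_neg (by omega), if_neg (by omega), if_pos h']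

theorem diagram_eq_hash {d m n : ℕ} (h : 3 * (d + 3 + m) ≤ n) :
    diagram M enc l d m n = enc .hash := by
  rw [diagram, if_neg (by omega), if_neg (by omega), if_neg (by omega), if_neg (by omega)]

theorem diagram_eq_ne {d m n : ℕ} (h : n < d + 3 + m) :
    ∃ z, diagram M enc l d m n = enc z ∧ z ≠ .hash ∧ z ≠ .E := by
  unfold diagram
  split_ifs
  · exact ⟨_, rfl, by simp, by simp⟩
  · exact ⟨_, rfl, by simp, by simp⟩
  · unfold diagramLetter
    split_ifs <;> exact ⟨_, rfl, by simp, by simp⟩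

theorem good_diagram (hl : l ≠ []) {k j : ℕ} (hk : 1 ≤ k) (hj : 1 ≤ j)
    (h : IsHalting M (row M l k j)) {d m : ℕ} (hd : d = l.length + j + 1) (hm : m = d * k + j) :
    Good (machineRules M hdec) (inputWord enc l) (diagram M enc l d m) (3 * (d + 3 + m)) d
      (d + 3 + m) j := by
  have hlen := length_inputWord (enc := enc) hl
  have hdk : d ≤ d * k := Nat.le_mul_of_pos_right d hk
  have hne {x y : Letter Γ Q} (hxy : x ≠ y) : enc x ≠ enc y := hdec.injective.ne hxy
  constructor
  · intro n hn
    by_cases h : n < d + 3 + m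
    · obtain ⟨z, hz, hz', -⟩ := diagram_eq_ne (M := M) (l := l) (enc := enc) h
      rw [hz]
      exact hne hz'
    · rw [diagram_eq_E (by omega) hn]
      exact hne (by simp)
  · exact diagram_eq_hash le_rfl
  · rintro n hn (⟨h1, h2, h3⟩ | ⟨h1, h2, h3⟩ | ⟨h1, h2⟩ | ⟨h1, h2, h3⟩)
    · have h4 : n < d + 3 + m := by
        by_contra h4
        exact h3 (diagram_eq_E (by omega) hn)
      have h5 : n = d + 2 + m := by
        by_contra h5
        obtain ⟨z, hz, -, hz'⟩ := diagram_eq_ne (M := M) (l := l) (enc := enc) (d := d) (m := m)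
          (n := n + 1) (by omega)
        exact hne hz' (hz.symm.trans h1)
      refine h2 ⟨_, ?_, h⟩
      rw [h5, diagram_eq_diagramLetter le_rfl (by omega), hm, Nat.mul_add_mod,
        Nat.mod_eq_of_lt (by omega), diagramLetter, if_neg (by omega),
        Nat.mul_add_div (by omega), Nat.div_eq_of_lt (by omega), add_zero]
    · have h4 : d + 3 + m ≤ n := by
        by_contra h4
        obtain ⟨z, hz, -, hz'⟩ := diagram_eq_ne (M := M) (l := l) (enc := enc) (d := d) (m := m)
          (n := n) (by omega)
        exact hne hz' (hz.symm.trans h1)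
      by_cases h5 : n + 1 < 3 * (d + 3 + m)
      · exact h2 (diagram_eq_E (by omega) h5)
      · exact h3 (diagram_eq_hash (by omega))
    · by_cases h4 : n + 1 < 3 * (d + 3 + m)
      · by_cases h5 : n + 1 < d + 3 + m
        · obtain ⟨z, hz, hz', -⟩ := diagram_eq_ne (M := M) (l := l) (enc := enc) h5
          exact hne hz' (hz.symm.trans h1)
        · exact hne (by simp) ((diagram_eq_E (by omega) h4).symm.trans h1)
      · exact h2 (diagram_eq_E (by omega) hn)
    · have h4 : n < d := by
        by_contra h4
        by_cases h5 : d + 3 + m ≤ n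
        · exact hne (by simp) ((diagram_eq_E h5 hn).symm.trans h1)
        by_cases h6 : n < d + 3
        · exact hne (by simp) ((diagram_eq_Y (by omega) h6).symm.trans h1)
        obtain ⟨i, rfl⟩ := Nat.exists_eq_add_of_le (show d + 2 ≤ n by omega)
        rw [diagram_eq_diagramLetter (by omega) (by omega), diagramLetter] at h1
        split_ifs at h1 <;> exact nomatch hdec.injective h1
      by_cases h5 : n + 1 < d
      · exact h2 (if_pos h5)
      · exact h3 (diagram_eq_Y (by omega) (by omega))
  · omega
  · intro n hn
    exact if_pos hn
  · exact diagram_eq_Y le_rfl (by omega)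
  · intro i a hi
    rcases i with _ | _ | i
    · obtain rfl := Option.some.inj hi
      exact diagram_eq_Y (by omega) (by omega)
    · obtain rfl := Option.some.inj hi
      exact diagram_eq_Y (by omega) (by omega)
    · have hi' : i < l.length := by
        have := (List.getElem?_eq_some_iff.1 hi).1
        omega
      rw [inputWord_getElem? M hl hi'] at hi
      rw [show d + 1 + (i + 1 + 1) = d + 2 + (i + 1) by omega,
        diagram_eq_cell (by omega) (by omega) (by omega)]
      exact Option.some.inj hi
  · intro i hi
    rw [hlen, show d + 1 + (l.length + 2) + i = d + 2 + (l.length + i + 1) by omega,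
      diagram_eq_cell (by omega) (by omega) (by omega), Nat.cast_add_one,
      row_zero_of_le M l hl (by omega)]
    rfl
  · rw [hlen, show d + 1 + (l.length + 2) + j = d + 2 + d by omega,
      diagram_eq_diagramLetter (by omega) (by omega), Nat.mod_self, diagramLetter, if_pos rfl]
    rfl
  · omega
  · intro n hn _
    by_cases h1 : n < d
    · exact fun h => hne (by simp) ((if_pos h1).symm.trans h)
    by_cases h2 : n < d + 3
    · exact fun h => hne (by simp) ((diagram_eq_Y (by omega) h2).symm.trans h)
    obtain ⟨i, rfl⟩ := Nat.exists_eq_add_of_le (show d + 2 ≤ n by omega)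
    rw [diagram_eq_cell (by omega) (by omega) (by omega)]
    exact hne (by simp)
  · omega
  · intro n h1 h2
    exact diagram_eq_E h1 h2
  · intro n hn
    obtain ⟨z, hz, -, hz'⟩ := diagram_eq_ne (M := M) (l := l) (enc := enc) hn
    rw [hz]
    exact hne hz'
  · omega
  · intro n h1 h2
    obtain ⟨i, rfl⟩ := Nat.exists_eq_add_of_le' h1
    rw [rules_eq_diagramLetter (by omega) i fun m' hm' => diagram_eq_row (by omega),
      show i + d + d + 2 = d + 2 + (i + d) by omega,
      diagram_eq_diagramLetter (by omega) (by omega)]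

/-- A diagram ending with a halted head exists if and only if the machine halts. -/
theorem exists_good_iff (hl : l ≠ []) :
    (∃ σ ℓ d N t, Good (machineRules M hdec) (inputWord enc l) σ ℓ d N t) ↔
      (eval (TM0.step (M : TM0.Machine Γ Q)) (TM0.init l)).Dom := by
  rw [dom_eval_iff]
  constructor
  · rintro ⟨σ, ℓ, d, N, t, g⟩
    exact g.exists_isHalting hl
  · rintro ⟨k, j, h⟩
    have hj : 0 < j := by
      by_contra hj
      rw [row_of_nonpos _ _ (by omega)] at h
      exact not_isHalting_blank h
    obtain ⟨j, rfl⟩ := Int.eq_ofNat_of_zero_le hj.le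
    exact ⟨_, _, _, _, _, good_diagram hl (k := k + 1) (j := j + 1) (by omega) (by omega)
      h.row_succ rfl rfl⟩

end Diagrams
end DiagGifs

namespace DiagGifs
open Finset

section Digits

variable {β : ℕ}

/-- The number with the first `n` digits of `σ` in base `2 ^ β` after the point. -/
noncomputable def digitSum (R : Type) [DivisionRing R] (σ : ℕ → Fin (2 ^ β)) (n : ℕ) : R :=
  ∑ i ∈ range n, ((σ i : ℕ) : R) / (2 ^ β) ^ (i + 1)

theorem cast_digitSum (σ : ℕ → Fin (2 ^ β)) (n : ℕ) :
    ((digitSum ℚ σ n : ℚ) : ℝ) = digitSum ℝ σ n := by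
  simp [digitSum]

theorem digitSum_congr {σ τ : ℕ → Fin (2 ^ β)} {n : ℕ} (h : ∀ i < n, σ i = τ i) (R : Type)
    [DivisionRing R] : digitSum R σ n = digitSum R τ n :=
  sum_congr rfl fun i hi => by rw [h i (mem_range.1 hi)]

theorem digitSum_succ (σ : ℕ → Fin (2 ^ β)) (n : ℕ) :
    digitSum ℝ σ (n + 1) = digitSum ℝ σ n + ((σ n : ℕ) : ℝ) / (2 ^ β) ^ (n + 1) :=
  sum_range_succ _ _

theorem digitSum_add (σ : ℕ → Fin (2 ^ β)) (n m : ℕ) :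
    digitSum ℝ σ (n + m) =
      digitSum ℝ σ n + digitSum ℝ (fun i => σ (n + i)) m / (2 ^ β) ^ n := by
  rw [digitSum, sum_range_add, digitSum, digitSum, sum_div]
  congr 1
  refine sum_congr rfl fun i _ => ?_
  rw [div_div, ← pow_add]
  congr 2
  omega

theorem digitSum_add_div (σ : ℕ → Fin (2 ^ β)) (n m : ℕ) (z : ℝ) :
    digitSum ℝ σ (n + m) + z / (2 ^ β) ^ (n + m) = digitSum ℝ σ n +
      (z / (2 ^ β) ^ m + digitSum ℝ (fun i => σ (n + i)) m) / (2 ^ β) ^ n := by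
  rw [digitSum_add, pow_add]
  field_simp
  ring

theorem digitSum_nonneg (σ : ℕ → Fin (2 ^ β)) (n : ℕ) : 0 ≤ digitSum ℝ σ n :=
  sum_nonneg fun _ _ => by positivity

theorem digitSum_add_le (σ : ℕ → Fin (2 ^ β)) (n : ℕ) :
    digitSum ℝ σ n + 1 / (2 ^ β) ^ n ≤ 1 := by
  induction n with
  | zero => simp [digitSum]
  | succ n ih =>
    refine le_trans ?_ ih
    have h : ((σ n : ℕ) : ℝ) + 1 ≤ 2 ^ β := by exact_mod_cast (σ n).2
    rw [digitSum_succ, add_assoc, ← add_div]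
    refine add_le_add_right ?_ _
    rw [pow_succ, div_le_div_iff₀ (by positivity) (by positivity)]
    nlinarith [show (0 : ℝ) < (2 ^ β) ^ n by positivity]

/-- A point of a small cell belongs to the larger ones. -/
theorem digitSum_le_and_le (σ : ℕ → Fin (2 ^ β)) {n m : ℕ} (h : n ≤ m) {z : ℝ} (h0 : 0 ≤ z)
    (h1 : z ≤ 1) : digitSum ℝ σ n ≤ digitSum ℝ σ m + z / (2 ^ β) ^ m ∧
      digitSum ℝ σ m + z / (2 ^ β) ^ m ≤ digitSum ℝ σ n + 1 / (2 ^ β) ^ n := by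
  obtain ⟨m, rfl⟩ := Nat.exists_eq_add_of_le h
  have h2 := digitSum_nonneg (fun i => σ (n + i)) m
  have h3 := digitSum_add_le (fun i => σ (n + i)) m
  have h4 : z / (2 ^ β) ^ m ≤ 1 / (2 ^ β) ^ m := by gcongr
  rw [digitSum_add_div]
  constructor
  · have : 0 ≤ (z / (2 ^ β) ^ m + digitSum ℝ (fun i => σ (n + i)) m) / (2 ^ β) ^ n := by
      positivity
    linarith
  · gcongr
    linarith

theorem exists_digitSum_eq (σ : ℕ → Fin (2 ^ β)) (n : ℕ) :
    ∃ k : ℤ, digitSum ℝ σ n = k / (2 ^ β) ^ n := by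
  induction n with
  | zero => exact ⟨0, by simp [digitSum]⟩
  | succ n ih =>
    obtain ⟨k, hk⟩ := ih
    refine ⟨k * 2 ^ β + (σ n : ℕ), ?_⟩
    rw [digitSum_succ, hk, pow_succ]
    push_cast
    field_simp

theorem eq_of_mem_cells {ρ σ : ℕ → Fin (2 ^ β)} {a b : ℕ} {z : ℝ} (h0 : 0 ≤ z) (h1 : z ≤ 1)
    (hl : digitSum ℝ σ b < digitSum ℝ ρ a + z / (2 ^ β) ^ a)
    (hr : digitSum ℝ ρ a + z / (2 ^ β) ^ a < digitSum ℝ σ b + 1 / (2 ^ β) ^ b)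
    {n : ℕ} (ha : n < a) (hb : n < b) : ρ n = σ n := by
  have key (m : ℕ) (ha : m ≤ a) (hb : m ≤ b) : digitSum ℝ ρ m = digitSum ℝ σ m := by
    obtain ⟨u, hu⟩ := exists_digitSum_eq ρ m
    obtain ⟨v, hv⟩ := exists_digitSum_eq σ m
    have h2 := digitSum_le_and_le ρ ha h0 h1
    have h3 := (digitSum_le_and_le σ hb le_rfl zero_le_one).1
    have h4 := (digitSum_le_and_le σ hb zero_le_one le_rfl).2
    have hB : (0 : ℝ) < (2 ^ β) ^ m := by positivity
    have h5 : digitSum ℝ ρ m < digitSum ℝ σ m + 1 / (2 ^ β) ^ m := by linarith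
    have h6 : digitSum ℝ σ m < digitSum ℝ ρ m + 1 / (2 ^ β) ^ m := by
      rw [zero_div, add_zero] at h3
      linarith
    rw [hu, hv, ← add_div, div_lt_div_iff_of_pos_right hB] at h5 h6
    have h7 : u < v + 1 := by exact_mod_cast h5
    have h8 : v < u + 1 := by exact_mod_cast h6
    rw [hu, hv, show u = v by omega]
  have h2 := key (n + 1) ha hb
  rw [digitSum_succ, digitSum_succ, key n ha.le hb.le, add_right_inj,
    div_left_inj' (by positivity)] at h2
  exact Fin.ext (by exact_mod_cast h2)

theorem exists_digits {x : ℝ} (h0 : 0 ≤ x) (h1 : x ≤ 1) (n : ℕ) : ∃ σ : ℕ → Fin (2 ^ β),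
    digitSum ℝ σ n ≤ x ∧ x ≤ digitSum ℝ σ n + 1 / (2 ^ β) ^ n := by
  induction n with
  | zero => exact ⟨fun _ => 0, by simpa [digitSum] using ⟨h0, h1⟩⟩
  | succ n ih =>
    obtain ⟨σ, hσ, hσ'⟩ := ih
    have hB : (0 : ℝ) < (2 ^ β) ^ (n + 1) := by positivity
    set y := (x - digitSum ℝ σ n) * (2 ^ β) ^ (n + 1) with hy
    have hy0 : 0 ≤ y := mul_nonneg (by linarith) hB.le
    have hy1 : y ≤ 2 ^ β := by
      have : x - digitSum ℝ σ n ≤ 1 / (2 ^ β) ^ n := by linarith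
      calc y ≤ 1 / (2 ^ β) ^ n * (2 ^ β) ^ (n + 1) :=
          mul_le_mul_of_nonneg_right this hB.le
        _ = 2 ^ β := by rw [pow_succ]; field_simp
    have hpos : 0 < 2 ^ β := by positivity
    obtain ⟨c, hc, hc0, hc1⟩ : ∃ c : ℕ, c < 2 ^ β ∧ (c : ℝ) ≤ y ∧ y ≤ c + 1 := by
      by_cases h : y = 2 ^ β
      · refine ⟨2 ^ β - 1, by omega, ?_, ?_⟩ <;>
          · rw [h, Nat.cast_sub hpos]
            push_cast
            linarith
      · refine ⟨⌊y⌋₊, ?_, Nat.floor_le hy0, (Nat.lt_floor_add_one y).le⟩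
        rw [Nat.floor_lt hy0]
        exact_mod_cast lt_of_le_of_ne hy1 h
    have hx : x = digitSum ℝ σ n + y / (2 ^ β) ^ (n + 1) := by
      rw [hy]
      field_simp
      ring
    refine ⟨fun i => if i < n then σ i else ⟨c, hc⟩, ?_⟩
    rw [digitSum_succ, if_neg (lt_irrefl n),
      digitSum_congr (τ := σ) fun i hi => if_pos hi, add_assoc, ← add_div, hx]
    exact ⟨by gcongr, by gcongr⟩

end Digits
end DiagGifs

namespace DiagGifs

/-- The vertex representing a state. -/
def St.code : St → ℕ
  | s0 => 0
  | scan => 1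
  | sink => 2
  | lt => 3
  | cb => 4
  | gt => 5
  | cc => 6
  | va => 7
  | mid => 8
  | p1 => 9
  | p2 => 10
  | p3 => 11
  | zs => 12
  | chain i => 13 + i

theorem St.code_injective : Function.Injective St.code := by
  intro p r h
  cases p <;> cases r <;> simp only [St.code] at h <;> first | rfl | (congr 1; omega)

section Geometry

variable {β : ℕ} {T : Rules (Fin (2 ^ β))} {w : List (Fin (2 ^ β))}

theorem Step.code_lt {A : Type} {T : Rules A} {w : List A} {x y : ℕ → A} {p r : St} {a b : ℕ}
    (h : Step T w x y p r a b) (hp : p.code < 14 + w.length) : r.code < 14 + w.length := by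
  cases h <;> simp only [St.code] at hp ⊢ <;> try omega
  case chain_go hw _ _ =>
    have := (List.getElem?_eq_some_iff.1 hw).1
    omega

/-- The edges of the system are the transitions of the automaton. -/
def IsEncoding (T : Rules (Fin (2 ^ β))) (w : List (Fin (2 ^ β))) (L : List DiagEdge) : Prop :=
  ∀ e, e ∈ L ↔ ∃ p r a b x y, Step T w x y p r a b ∧ p.code < 14 + w.length ∧
    e = (p.code, r.code, ![β * a, β * b], ![digitSum ℚ x a, digitSum ℚ y b])

theorem diagEdgeMap_apply (m : Fin 2 → ℕ) (v : Fin 2 → ℚ) (z : EuclideanSpace ℝ (Fin 2))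
    (i : Fin 2) : diagEdgeMap m v z i = z i / 2 ^ m i + v i := rfl

theorem diagEdgeMap_zero (a b : ℕ) (x y : ℕ → Fin (2 ^ β)) (z : EuclideanSpace ℝ (Fin 2)) :
    diagEdgeMap ![β * a, β * b] ![digitSum ℚ x a, digitSum ℚ y b] z 0 =
      z 0 / (2 ^ β) ^ a + digitSum ℝ x a := by
  rw [diagEdgeMap_apply, ← pow_mul, ← cast_digitSum]
  rfl

theorem diagEdgeMap_one (a b : ℕ) (x y : ℕ → Fin (2 ^ β)) (z : EuclideanSpace ℝ (Fin 2)) :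
    diagEdgeMap ![β * a, β * b] ![digitSum ℚ x a, digitSum ℚ y b] z 1 =
      z 1 / (2 ^ β) ^ b + digitSum ℝ y b := by
  rw [diagEdgeMap_apply, ← pow_mul, ← cast_digitSum]
  rfl

theorem continuous_diagEdgeMap (m : Fin 2 → ℕ) (v : Fin 2 → ℚ) :
    Continuous (diagEdgeMap m v) := by
  refine (PiLp.continuous_toLp 2 _).comp (continuous_pi fun i => ?_)
  fun_prop

theorem injective_diagEdgeMap (m : Fin 2 → ℕ) (v : Fin 2 → ℚ) :
    Function.Injective (diagEdgeMap m v) := by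
  intro x y h
  ext i
  have := congrArg (fun z : EuclideanSpace ℝ (Fin 2) => z i) h
  simp only [diagEdgeMap_apply, add_left_inj] at this
  exact (div_left_inj' (by positivity)).1 this

theorem IsEncoding.bounds {L : List DiagEdge} (hL : IsEncoding T w L) (hβ : 1 ≤ β) {e : DiagEdge}
    (he : e ∈ L) (i : Fin 2) : 1 ≤ e.2.2.1 i ∧ (0 : ℝ) ≤ e.2.2.2 i ∧
      (e.2.2.2 i : ℝ) + 1 / 2 ^ e.2.2.1 i ≤ 1 := by
  obtain ⟨p, r, a, b, x, y, h, -, rfl⟩ := (hL e).1 he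
  have := h.bounds
  fin_cases i
  · refine ⟨Nat.mul_pos hβ this.1, ?_, ?_⟩
    · exact (digitSum_nonneg x a).trans_eq (cast_digitSum x a).symm
    · have := digitSum_add_le x a
      rwa [← pow_mul, ← cast_digitSum] at this
  · refine ⟨Nat.mul_pos hβ this.2.2.1, ?_, ?_⟩
    · exact (digitSum_nonneg y b).trans_eq (cast_digitSum y b).symm
    · have := digitSum_add_le y b
      rwa [← pow_mul, ← cast_digitSum] at this

theorem IsEncoding.code_lt {L : List DiagEdge} (hL : IsEncoding T w L) {e : DiagEdge}
    (he : e ∈ L) : e.1 < 14 + w.length ∧ e.2.1 < 14 + w.length := by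
  obtain ⟨p, r, a, b, x, y, h, hp, rfl⟩ := (hL e).1 he
  exact ⟨hp, h.code_lt hp⟩

theorem continuous_coord (i : Fin 2) : Continuous fun z : EuclideanSpace ℝ (Fin 2) => z i := by
  fun_prop

theorem isAttractor_mem_iff {k : ℕ} {L : List DiagEdge}
    {X : ℕ → Set (EuclideanSpace ℝ (Fin 2))} (hX : IsDiagGifsAttractor k L X) {p : ℕ}
    (hp : p < k) (z : EuclideanSpace ℝ (Fin 2)) :
    z ∈ X p ↔ ∃ e ∈ L, e.1 = p ∧ ∃ z' ∈ X e.2.1, diagEdgeMap e.2.2.1 e.2.2.2 z' = z := by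
  rw [hX.2 p hp]
  simp only [Set.mem_iUnion, Set.mem_image, exists_prop]

/-- The attractors are contained in the unit square. -/
theorem IsEncoding.mem_Icc {L : List DiagEdge} (hL : IsEncoding T w L) (hβ : 1 ≤ β)
    {X : ℕ → Set (EuclideanSpace ℝ (Fin 2))} (hX : IsDiagGifsAttractor (14 + w.length) L X)
    {p : ℕ} (hp : p < 14 + w.length) {z : EuclideanSpace ℝ (Fin 2)} (hz : z ∈ X p) (i : Fin 2) :
    0 ≤ z i ∧ z i ≤ 1 := by
  set S : Set (EuclideanSpace ℝ (Fin 2)) := ⋃ p ∈ Set.Iio (14 + w.length), X p with hS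
  have hSc : IsCompact S := (Set.finite_Iio _).isCompact_biUnion fun p hp => (hX.1 p hp).2
  have hzS : z ∈ S := Set.mem_biUnion hp hz
  have step {y : EuclideanSpace ℝ (Fin 2)} (hy : y ∈ S) :
      ∃ y' ∈ S, ∃ e ∈ L, y i = y' i / 2 ^ e.2.2.1 i + e.2.2.2 i := by
    obtain ⟨p, hp, hy⟩ := Set.mem_iUnion₂.1 hy
    obtain ⟨e, he, -, y', hy', rfl⟩ := (isAttractor_mem_iff hX hp y).1 hy
    exact ⟨y', Set.mem_biUnion (hL.code_lt he).2 hy', e, he, rfl⟩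
  constructor
  · obtain ⟨y, hy, hmin⟩ := hSc.exists_isMinOn ⟨z, hzS⟩ (continuous_coord i).continuousOn
    refine le_trans ?_ (hmin hzS)
    obtain ⟨y', hy', e, he, hyy⟩ := step hy
    obtain ⟨h1, h2, h3⟩ := hL.bounds hβ he i
    have h4 : y i ≤ y' i := hmin hy'
    have h5 : (2 : ℝ) ≤ 2 ^ e.2.2.1 i := le_self_pow₀ one_le_two (by omega)
    have h6 : y i / 2 ^ e.2.2.1 i ≤ y' i / 2 ^ e.2.2.1 i := by gcongr
    by_contra hneg
    have h7 : y i / 2 ^ e.2.2.1 i > y i := by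
      rw [gt_iff_lt, lt_div_iff₀ (by positivity)]
      nlinarith
    linarith
  · obtain ⟨y, hy, hmax⟩ := hSc.exists_isMaxOn ⟨z, hzS⟩ (continuous_coord i).continuousOn
    refine le_trans (hmax hzS) ?_
    obtain ⟨y', hy', e, he, hyy⟩ := step hy
    obtain ⟨h1, h2, h3⟩ := hL.bounds hβ he i
    have h4 : y' i ≤ y i := hmax hy'
    have h5 : (2 : ℝ) ≤ 2 ^ e.2.2.1 i := le_self_pow₀ one_le_two (by omega)
    have h6 : y' i / 2 ^ e.2.2.1 i ≤ y i / 2 ^ e.2.2.1 i := by gcongr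
    by_contra hneg
    have h7 : (y i - 1) / 2 ^ e.2.2.1 i < y i - 1 := by
      rw [div_lt_iff₀ (by positivity)]
      nlinarith
    rw [sub_div] at h7
    linarith

end Geometry
end DiagGifs

namespace DiagGifs
open Set

section Geometry

variable {β : ℕ} {T : Rules (Fin (2 ^ β))} {w : List (Fin (2 ^ β))} {L : List DiagEdge}
  {X : ℕ → Set (EuclideanSpace ℝ (Fin 2))} {p r : St}

/-- The approximations of the attractors from above. -/
def approx (L : List DiagEdge) : ℕ → ℕ → Set (EuclideanSpace ℝ (Fin 2))
  | 0, _ => {z | ∀ i, z i ∈ Icc (0 : ℝ) 1}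
  | n + 1, p => ⋃ e ∈ {e | e ∈ L}, ⋃ (_ : e.1 = p), diagEdgeMap e.2.2.1 e.2.2.2 '' approx L n e.2.1

theorem mem_approx_succ {n p : ℕ} {z : EuclideanSpace ℝ (Fin 2)} : z ∈ approx L (n + 1) p ↔
    ∃ e ∈ L, e.1 = p ∧ ∃ z' ∈ approx L n e.2.1, diagEdgeMap e.2.2.1 e.2.2.2 z' = z := by
  simp only [approx, mem_iUnion, mem_image, exists_prop, mem_ofPred_eq]

theorem isCompact_approx (n p : ℕ) : IsCompact (approx L n p) := by
  induction n generalizing p with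
  | zero =>
    have h : IsCompact (univ.pi fun _ : Fin 2 => Icc (0 : ℝ) 1) :=
      isCompact_univ_pi fun _ => isCompact_Icc
    refine (h.image (PiLp.continuous_toLp 2 fun _ : Fin 2 => ℝ)).of_isClosed_subset ?_ ?_
    · simp only [approx, ofPred_forall]
      exact isClosed_iInter fun i => isClosed_Icc.preimage (continuous_coord i)
    · intro z hz
      exact ⟨WithLp.ofLp z, fun i _ => hz i, rfl⟩
  | succ n ih =>
    refine (List.finite_toSet L).isCompact_biUnion fun e _ => isCompact_iUnion fun _ => ?_
    exact (ih _).image (continuous_diagEdgeMap _ _)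

theorem IsEncoding.approx_succ_subset (hL : IsEncoding T w L) (hβ : 1 ≤ β) (n p : ℕ) :
    approx L (n + 1) p ⊆ approx L n p := by
  induction n generalizing p with
  | zero =>
    intro z hz i
    obtain ⟨e, he, -, z', hz', rfl⟩ := mem_approx_succ.1 hz
    obtain ⟨h1, h2, h3⟩ := hL.bounds hβ he i
    obtain ⟨h4, h5⟩ := hz' i
    have h6 : z' i / 2 ^ e.2.2.1 i ≤ 1 / 2 ^ e.2.2.1 i := by gcongr
    rw [diagEdgeMap_apply]
    exact ⟨by positivity, by linarith⟩
  | succ n ih =>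
    intro z hz
    obtain ⟨e, he, hp, z', hz', rfl⟩ := mem_approx_succ.1 hz
    exact mem_approx_succ.2 ⟨e, he, hp, z', ih _ hz', rfl⟩

/-- The attractors exist. -/
theorem IsEncoding.exists_attractor (hL : IsEncoding T w L) (hβ : 1 ≤ β)
    (hwf : ∀ p < 14 + w.length, ∃ e ∈ L, e.1 = p) :
    ∃ X, IsDiagGifsAttractor (14 + w.length) L X := by
  have hanti (p : ℕ) : Antitone fun n => approx L n p :=
    antitone_nat_of_succ_le fun n => hL.approx_succ_subset hβ n p
  have hne (n : ℕ) : ∀ p < 14 + w.length, (approx L n p).Nonempty := by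
    induction n with
    | zero => exact fun p _ => ⟨0, fun i => by simp⟩
    | succ n ih =>
      intro p hp
      obtain ⟨e, he, rfl⟩ := hwf p hp
      obtain ⟨z, hz⟩ := ih _ (hL.code_lt he).2
      exact ⟨_, mem_approx_succ.2 ⟨e, he, rfl, z, hz, rfl⟩⟩
  refine ⟨fun p => ⋂ n, approx L n p, fun p hp => ⟨?_, ?_⟩, fun p hp => ?_⟩
  · exact IsCompact.nonempty_iInter_of_sequence_nonempty_isCompact_isClosed _
      (fun n => hL.approx_succ_subset hβ n p) (fun n => hne n p hp) (isCompact_approx 0 p)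
      fun n => (isCompact_approx n p).isClosed
  · exact (isCompact_approx 0 p).of_isClosed_subset
      (isClosed_iInter fun n => (isCompact_approx n p).isClosed) (iInter_subset _ 0)
  · ext z
    simp only [mem_iUnion, mem_image, exists_prop, mem_iInter]
    constructor
    · intro hz
      by_contra! hcon
      have h1 : ∀ e ∈ {e | e ∈ L}, ∀ᶠ n in Filter.atTop,
          e.1 = p → z ∉ diagEdgeMap e.2.2.1 e.2.2.2 '' approx L n e.2.1 := by
        intro e he
        by_cases hp : e.1 = p
        · by_cases h : ∃ z', diagEdgeMap e.2.2.1 e.2.2.2 z' = z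
          · obtain ⟨z', rfl⟩ := h
            obtain ⟨n, hn⟩ : ∃ n, z' ∉ approx L n e.2.1 := by
              by_contra! h
              exact hcon e he hp z' h rfl
            filter_upwards [Filter.eventually_ge_atTop n] with m hm _ hmem
            rw [(injective_diagEdgeMap _ _).mem_set_image] at hmem
            exact hn (hanti _ hm hmem)
          · exact .of_forall fun n _ ⟨z', _, h'⟩ => h ⟨z', h'⟩
        · exact .of_forall fun n h => absurd h hp
      obtain ⟨n, hn⟩ := ((List.finite_toSet L).eventually_all.2 h1).exists
      obtain ⟨e, he, hp, hz'⟩ := mem_approx_succ.1 (hz (n + 1))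
      exact hn e he hp hz'
    · rintro ⟨e, he, hp, z', hz', rfl⟩ n
      exact hL.approx_succ_subset hβ n p (mem_approx_succ.2 ⟨e, he, hp, z', hz' n, rfl⟩)

/-- Runs of the automaton produce points of the attractors. -/
theorem IsEncoding.exists_mem_of_reach (hL : IsEncoding T w L)
    (hX : IsDiagGifsAttractor (14 + w.length) L X) {σ τ : ℕ → Fin (2 ^ β)} {i j i' j' : ℕ}
    (h : Reach T w σ τ p i j r i' j') (hp : p.code < 14 + w.length) :
    r.code < 14 + w.length ∧ ∀ z' ∈ X r.code, ∃ z ∈ X p.code,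
      digitSum ℝ σ i + z 0 / (2 ^ β) ^ i = digitSum ℝ σ i' + z' 0 / (2 ^ β) ^ i' ∧
      digitSum ℝ τ j + z 1 / (2 ^ β) ^ j = digitSum ℝ τ j' + z' 1 / (2 ^ β) ^ j' := by
  induction h with
  | refl => exact ⟨hp, fun z' hz' => ⟨z', hz', rfl, rfl⟩⟩
  | tail h hs ih =>
    obtain ⟨hr, ih⟩ := ih
    refine ⟨hs.code_lt hr, fun z' hz' => ?_⟩
    obtain ⟨z, hz, h1, h2⟩ := ih _ ((isAttractor_mem_iff hX hr _).2
      ⟨_, (hL _).2 ⟨_, _, _, _, _, _, hs, hr, rfl⟩, rfl, z', hz', rfl⟩)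
    refine ⟨z, hz, ?_, ?_⟩
    · rw [h1, digitSum_add_div, diagEdgeMap_zero]
    · rw [h2, digitSum_add_div, diagEdgeMap_one]

/-- Points of the attractors come from runs of the automaton. -/
theorem IsEncoding.exists_reach_of_mem (hL : IsEncoding T w L)
    (hX : IsDiagGifsAttractor (14 + w.length) L X) (hp : p.code < 14 + w.length)
    {z : EuclideanSpace ℝ (Fin 2)} (hz : z ∈ X p.code) (n : ℕ) :
    ∃ σ τ r i j, n ≤ i ∧ n ≤ j ∧ Reach T w σ τ p 0 0 r i j ∧ r.code < 14 + w.length ∧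
      ∃ z' ∈ X r.code, z 0 = digitSum ℝ σ i + z' 0 / (2 ^ β) ^ i ∧
        z 1 = digitSum ℝ τ j + z' 1 / (2 ^ β) ^ j := by
  induction n with
  | zero =>
    exact ⟨fun _ => 0, fun _ => 0, p, 0, 0, le_rfl, le_rfl, .refl, hp, z, hz,
      by simp [digitSum], by simp [digitSum]⟩
  | succ n ih =>
    obtain ⟨σ, τ, r, i, j, hi, hj, hre, hr, z', hz', h0, h1⟩ := ih
    obtain ⟨e, he, her, z'', hz'', rfl⟩ := (isAttractor_mem_iff hX hr _).1 hz'
    obtain ⟨p', r', a, b, x, y, hs, hp', rfl⟩ := (hL e).1 he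
    obtain rfl := St.code_injective her
    have hb := hs.bounds
    have hσ (m : ℕ) : (fun m => if m < i then σ m else x (m - i)) (i + m) = x m := by simp
    have hτ (m : ℕ) : (fun m => if m < j then τ m else y (m - j)) (j + m) = y m := by simp
    refine ⟨fun m => if m < i then σ m else x (m - i),
      fun m => if m < j then τ m else y (m - j), r', i + a, j + b, by omega, by omega, ?_,
      hs.code_lt hp', z'', hz'', ?_, ?_⟩
    · refine .tail (hre.congr ?_ ?_) (hs.congr ?_ ?_)
      · exact fun m hm => (if_pos hm).symm
      · exact fun m hm => (if_pos hm).symm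
      · exact fun m _ => (hσ m).symm
      · exact fun m _ => (hτ m).symm
    · rw [h0, digitSum_add_div, diagEdgeMap_zero, funext hσ,
        digitSum_congr fun m (hm : m < i) => if_pos hm]
    · rw [h1, digitSum_add_div, diagEdgeMap_one, funext hτ,
        digitSum_congr fun m (hm : m < j) => if_pos hm]

end Geometry
end DiagGifs

namespace DiagGifs
open Set

theorem exists_box_subset {U : Set (EuclideanSpace ℝ (Fin 2))} (hU : IsOpen U)
    {x : EuclideanSpace ℝ (Fin 2)} (hx : x ∈ U) :
    ∃ ε > 0, ∀ y : EuclideanSpace ℝ (Fin 2), (∀ i, |y i - x i| < ε) → y ∈ U := by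
  have h := hU.preimage (PiLp.continuous_toLp 2 fun _ : Fin 2 => ℝ)
  obtain ⟨ε, hε, hball⟩ := Metric.isOpen_iff.1 h (WithLp.ofLp x) hx
  refine ⟨ε, hε, fun y hy => ?_⟩
  exact hball (show WithLp.ofLp y ∈ _ by
    rw [Metric.mem_ball, dist_pi_lt_iff hε]
    exact fun i => hy i)

section Geometry

variable {β : ℕ} {T : Rules (Fin (2 ^ β))} {w : List (Fin (2 ^ β))} {L : List DiagEdge}
  {X : ℕ → Set (EuclideanSpace ℝ (Fin 2))}

theorem exists_one_div_pow_lt (hβ : 1 ≤ β) {ε : ℝ} (hε : 0 < ε) :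
    ∃ n : ℕ, 1 / (2 ^ β : ℝ) ^ n < ε := by
  obtain ⟨n, hn⟩ := exists_pow_lt_of_lt_one hε (y := 1 / (2 ^ β : ℝ)) (by
    rw [div_lt_one (by positivity)]
    exact one_lt_pow₀ one_lt_two (by omega))
  exact ⟨n, by rwa [← one_div_pow]⟩

theorem IsEncoding.mem_of_no_good (hL : IsEncoding T w L) (hβ : 1 ≤ β)
    (hX : IsDiagGifsAttractor (14 + w.length) L X) (hno : ∀ ρ ℓ d M t, ¬ Good T w ρ ℓ d M t)
    {x : EuclideanSpace ℝ (Fin 2)} (hx : ∀ i, 0 ≤ x i ∧ x i ≤ 1) : x ∈ X 0 := by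
  have hp : St.s0.code < 14 + w.length := by simp [St.code]
  have hX0 := hX.1 _ hp
  by_contra hx'
  obtain ⟨ε, hε, hbox⟩ := exists_box_subset hX0.2.isClosed.isOpen_compl hx'
  obtain ⟨n, hn⟩ := exists_one_div_pow_lt hβ hε
  obtain ⟨σ, hσ, hσ'⟩ := exists_digits (β := β) (hx 0).1 (hx 0).2 n
  obtain ⟨τ, hτ, hτ'⟩ := exists_digits (β := β) (hx 1).1 (hx 1).2 n
  obtain ⟨i, j, hi, hj, hre⟩ := exists_reach_of_no_good hno n n
    (σ := fun m => if m < n then σ m else T.hash) (τ := fun m => if m < n then τ m else T.hash)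
    (fun m hm => if_neg (by omega)) (fun m hm => if_neg (by omega))
  obtain ⟨z', hz'⟩ := hX0.1
  obtain ⟨z, hz, h0, h1⟩ := (hL.exists_mem_of_reach hX hre hp).2 z' hz'
  have hb := hL.mem_Icc hβ hX hp hz'
  have h2 := digitSum_le_and_le (fun m => if m < n then σ m else T.hash) hi (hb 0).1 (hb 0).2
  have h3 := digitSum_le_and_le (fun m => if m < n then τ m else T.hash) hj (hb 1).1 (hb 1).2
  rw [← h0, digitSum_congr fun m (hm : m < n) => if_pos hm] at h2
  rw [← h1, digitSum_congr fun m (hm : m < n) => if_pos hm] at h3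
  simp only [digitSum, Finset.range_zero, Finset.sum_empty, pow_zero, div_one, zero_add] at h2 h3
  simp only [digitSum] at hσ hσ' hτ hτ'
  refine hbox z (fun k => ?_) hz
  fin_cases k
  · exact abs_lt.2 ⟨by dsimp only [Fin.zero_eta]; linarith, by dsimp only [Fin.zero_eta]; linarith⟩
  · exact abs_lt.2 ⟨by dsimp only [Fin.mk_one]; linarith, by dsimp only [Fin.mk_one]; linarith⟩

theorem IsEncoding.interior_eq_empty_iff (hL : IsEncoding T w L) (hβ : 1 ≤ β)
    (hX : IsDiagGifsAttractor (14 + w.length) L X) :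
    interior (X 0) = ∅ ↔ ∃ ρ ℓ d M t, Good T w ρ ℓ d M t := by
  have hp : St.s0.code < 14 + w.length := by simp [St.code]
  constructor
  · intro h
    by_contra! hno
    have hopen : IsOpen {x : EuclideanSpace ℝ (Fin 2) | ∀ i, x i ∈ Ioo (0 : ℝ) 1} := by
      simp only [ofPred_forall]
      exact isOpen_iInter_of_finite fun i => isOpen_Ioo.preimage (continuous_coord i)
    have hsub : {x : EuclideanSpace ℝ (Fin 2) | ∀ i, x i ∈ Ioo (0 : ℝ) 1} ⊆ X 0 := fun x hx =>
      hL.mem_of_no_good hβ hX hno fun i => ⟨(hx i).1.le, (hx i).2.le⟩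
    replace hsub := interior_maximal hsub hopen
    rw [h] at hsub
    exact hsub (show WithLp.toLp 2 (fun _ : Fin 2 => (1 / 2 : ℝ)) ∈ _ from
      fun i => ⟨by norm_num, by norm_num⟩)
  · rintro ⟨ρ, ℓ, d, M, t, g⟩
    by_contra hne
    obtain ⟨x, hx⟩ := nonempty_iff_ne_empty.2 hne
    obtain ⟨ε, hε, hbox⟩ := exists_box_subset isOpen_interior hx
    obtain ⟨n, hn⟩ := exists_one_div_pow_lt hβ hε
    have hxb := hL.mem_Icc hβ hX hp (interior_subset hx)
    obtain ⟨σ, hσ, hσ'⟩ := exists_digits (β := β) (hxb 0).1 (hxb 0).2 n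
    obtain ⟨τ, hτ, hτ'⟩ := exists_digits (β := β) (hxb 1).1 (hxb 1).2 n
    obtain ⟨σ₁, τ₁, K, hσ₁, hτ₁, hstuck⟩ := exists_stuck_of_good g n n σ τ
    have h2 := digitSum_le_and_le σ₁ (le_max_left n K) (z := 1 / 2) (by norm_num) (by norm_num)
    have h3 := digitSum_le_and_le τ₁ (le_max_left n K) (z := 1 / 2) (by norm_num) (by norm_num)
    rw [digitSum_congr hσ₁] at h2
    rw [digitSum_congr hτ₁] at h3
    set N := max n K
    let z : EuclideanSpace ℝ (Fin 2) := WithLp.toLp 2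
      ![digitSum ℝ σ₁ N + 1 / 2 / (2 ^ β) ^ N, digitSum ℝ τ₁ N + 1 / 2 / (2 ^ β) ^ N]
    have hz : z ∈ X St.s0.code := interior_subset (hbox z fun k => by
      fin_cases k
      · exact abs_lt.2 ⟨by dsimp [z]; linarith, by dsimp [z]; linarith⟩
      · exact abs_lt.2 ⟨by dsimp [z]; linarith, by dsimp [z]; linarith⟩)
    obtain ⟨σ₂, τ₂, r, i, j, hi, hj, hre, hr, z', hz', h0, h1⟩ :=
      hL.exists_reach_of_mem hX hp hz N
    have hb := hL.mem_Icc hβ hX hr hz'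
    have h4 : 0 < 1 / 2 / (2 ^ β : ℝ) ^ N := by positivity
    have h5 : 1 / 2 / (2 ^ β : ℝ) ^ N < 1 / (2 ^ β : ℝ) ^ N := by gcongr; norm_num
    refine hstuck σ₂ τ₂ (fun m hm => ?_) (fun m hm => ?_) r i j (by omega) (by omega) hre
    · refine eq_of_mem_cells (a := i) (b := N) (hb 0).1 (hb 0).2 ?_ ?_ (by omega) (by omega) <;>
        rw [← h0]
      · exact lt_add_of_pos_right _ h4
      · exact add_lt_add_right h5 _
    · refine eq_of_mem_cells (a := j) (b := N) (hb 1).1 (hb 1).2 ?_ ?_ (by omega) (by omega) <;>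
        rw [← h1]
      · exact lt_add_of_pos_right _ h4
      · exact add_lt_add_right h5 _

end Geometry
end DiagGifs

namespace DiagGifs

section Instances

variable {A : Type} {T : Rules A} {w u : List A} {x y : ℕ → A} {p r : St} {a b i : ℕ}

/-- The word only matters in the states of the chain. -/
theorem Step.of_code_lt (h : Step T w x y p r a b) (hp : p.code < 13) : Step T u x y p r a b := by
  cases h
  case cb_end => apply Step.cb_end <;> assumption
  case cc_end => apply Step.cc_end <;> assumption
  case sink_one => apply Step.sink_one <;> assumption
  case sink_end_two => apply Step.sink_end_two <;> assumption
  case p3_end => apply Step.p3_end <;> assumption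
  all_goals first | (simp only [St.code] at hp; omega) | (constructor <;> assumption)

/-- The code of a state after shifting the chain by `i`. -/
def shiftCode (i c : ℕ) : ℕ := if c < 13 then c else c + i

theorem Step.chain_local (h : Step T w x y (.chain i) r a b) :
    ∃ r', Step T (w[i]?).toList x y (.chain 0) r' a b ∧ r.code = shiftCode i r'.code := by
  generalize hq : St.chain i = q at h
  cases h
  case chain_go hw hx hy =>
    obtain rfl := St.chain.inj hq
    exact ⟨.chain 1, .chain_go (by rw [hw]; rfl) hx hy, by simp [shiftCode, St.code]; omega⟩
  case chain_ne hw hne hx hy =>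
    obtain rfl := St.chain.inj hq
    exact ⟨.sink, .chain_ne (by rw [hw]; rfl) hne hx hy, rfl⟩
  case chain_end hi hx hy => exact ⟨.s0, .chain_end (Nat.zero_le _) hx hy, rfl⟩
  case tail_go hi hx hy =>
    obtain rfl := St.chain.inj hq
    exact ⟨.chain 0, .tail_go (by simp [hi]) hx hy, by simp [shiftCode, St.code]⟩
  case tail_ne hi hB hW hx hy =>
    obtain rfl := St.chain.inj hq
    exact ⟨.sink, .tail_ne (by simp [hi]) hB hW hx hy, rfl⟩
  all_goals first | (cases hq; done) | (subst hq; simp_all)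

theorem Step.chain_global (hi : i ≤ w.length)
    (h : Step T (w[i]?).toList x y (.chain 0) r a b) :
    ∃ r', Step T w x y (.chain i) r' a b ∧ r'.code = shiftCode i r.code := by
  have hnone (h : 0 = (w[i]?).toList.length) : i = w.length := by
    cases hw : w[i]? with
    | none => exact le_antisymm hi (List.getElem?_eq_none_iff.1 hw)
    | some c => simp [hw] at h
  have hsome {c : A} (h : (w[i]?).toList[0]? = some c) : w[i]? = some c := by
    cases hw : w[i]? with
    | none => simp [hw] at h
    | some c' => simpa [hw] using h
  generalize hq : St.chain 0 = q at h
  cases h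
  case chain_go hw hx hy =>
    obtain rfl := St.chain.inj hq
    exact ⟨.chain (i + 1), .chain_go (hsome hw) hx hy, by simp [shiftCode, St.code]; omega⟩
  case chain_ne hw hne hx hy =>
    obtain rfl := St.chain.inj hq
    exact ⟨.sink, .chain_ne (hsome hw) hne hx hy, rfl⟩
  case chain_end _ hx hy => exact ⟨.s0, .chain_end hi hx hy, rfl⟩
  case tail_go hi hx hy =>
    obtain rfl := St.chain.inj hq
    exact ⟨.chain i, .tail_go (hnone hi) hx hy, by simp [shiftCode, St.code]⟩
  case tail_ne hi hB hW hx hy =>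
    obtain rfl := St.chain.inj hq
    exact ⟨.sink, .tail_ne (hnone hi) hB hW hx hy, rfl⟩
  all_goals first | (cases hq; done) | (subst hq; simp_all)

theorem St.exists_code_eq (c : ℕ) : ∃ p : St, p.code = c := by
  by_cases h : c < 13
  · interval_cases c
    exacts [⟨.s0, rfl⟩, ⟨.scan, rfl⟩, ⟨.sink, rfl⟩, ⟨.lt, rfl⟩, ⟨.cb, rfl⟩, ⟨.gt, rfl⟩, ⟨.cc, rfl⟩,
      ⟨.va, rfl⟩, ⟨.mid, rfl⟩, ⟨.p1, rfl⟩, ⟨.p2, rfl⟩, ⟨.p3, rfl⟩, ⟨.zs, rfl⟩]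
  · exact ⟨.chain (c - 13), by simp only [St.code]; omega⟩

theorem exists_step (hp : p.code < 14 + w.length) :
    ∃ r a b x y, Step T w x y p r a b := by
  have hZ := T.Z_ne_hash
  have hE := T.Z_ne_E
  cases p with
  | s0 => exact ⟨_, _, _, fun _ => T.hash, fun _ => T.hash, .s0_end rfl rfl⟩
  | scan => exact ⟨_, _, _, fun _ => T.Z, fun _ => T.Z, .scan_go (.inr rfl) hZ hZ⟩
  | sink => exact ⟨_, _, _, fun _ => T.Z, fun _ => T.Z, .sink_one hZ hZ⟩
  | lt => exact ⟨_, _, _, fun _ => T.Z, fun _ => T.Z, .lt_one hZ hZ⟩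
  | cb => exact ⟨_, _, _, fun _ => T.Z, fun _ => T.Z, .cb_go (.inr rfl) hZ hZ hZ⟩
  | gt => exact ⟨_, _, _, fun _ => T.Z, fun _ => T.Z, .gt_one hZ hZ⟩
  | cc => exact ⟨_, _, _, fun _ => T.Z, fun _ => T.Z, .cc_go (.inr rfl) hZ hZ hZ⟩
  | va => exact ⟨_, _, _, fun _ => T.Z, fun _ => T.Z, .va_go (.inr rfl) rfl hZ hZ⟩
  | mid => exact ⟨_, _, _, fun _ => T.Z, fun _ => T.Z, .mid_go hZ hZ⟩
  | p1 => exact ⟨_, _, _, fun _ => T.Z, fun _ => T.Z, .p1_go (.inr rfl) hZ hZ hZ hE hE⟩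
  | p2 => exact ⟨_, _, _, fun _ => T.Z, fun _ => T.Z, .p2_go (.inr rfl) hZ hZ hE⟩
  | p3 => exact ⟨_, _, _, fun _ => T.Z, fun _ => T.E, .p3_go (.inr (.inr rfl)) hZ hZ rfl⟩
  | zs => exact ⟨_, _, _, fun _ => T.Z, fun _ => T.Z, .zs_go (.inr rfl) rfl hZ⟩
  | chain i =>
    refine ⟨_, _, _, fun _ => T.hash, fun _ => T.hash, .chain_end ?_ rfl rfl⟩
    simp only [St.code] at hp
    omega

end Instances
end DiagGifs

namespace DiagGifs

section Instances

variable {β : ℕ} (T : Rules (Fin (2 ^ β))) (w : List (Fin (2 ^ β)))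

/-- The edges given by the transitions of the automaton. -/
def edgeSet : Set DiagEdge :=
  {e | ∃ p r a b x y, Step T w x y p r a b ∧ p.code < 14 + w.length ∧
    e = (p.code, r.code, ![β * a, β * b], ![digitSum ℚ x a, digitSum ℚ y b])}

theorem finite_edgeSet : (edgeSet T w).Finite := by
  let ext (x : Fin 3 → Fin (2 ^ β)) (n : ℕ) : Fin (2 ^ β) := x (Fin.ofNat 3 n)
  have hext (x : ℕ → Fin (2 ^ β)) {a : ℕ} (ha : a ≤ 3) :
      digitSum ℚ x a = digitSum ℚ (ext fun i => x i) a :=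
    digitSum_congr (fun i hi => congrArg x (Nat.mod_eq_of_lt (by omega)).symm) ℚ
  refine (Set.finite_range fun t : Fin (14 + w.length) × Fin (14 + w.length) × Fin 4 × Fin 4 ×
    (Fin 3 → Fin (2 ^ β)) × (Fin 3 → Fin (2 ^ β)) =>
    ((t.1, t.2.1, ![β * t.2.2.1, β * t.2.2.2.1], ![digitSum ℚ (ext t.2.2.2.2.1) t.2.2.1,
      digitSum ℚ (ext t.2.2.2.2.2) t.2.2.2.1]) : DiagEdge)).subset ?_
  rintro e ⟨p, r, a, b, x, y, h, hp, rfl⟩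
  have hb := h.bounds
  refine ⟨(⟨p.code, hp⟩, ⟨r.code, h.code_lt hp⟩, ⟨a, by omega⟩, ⟨b, by omega⟩, fun i => x i,
    fun i => y i), ?_⟩
  rw [hext x hb.2.1, hext y hb.2.2.2]

/-- An enumeration of the edges which depends on `w` in a noncomputable way. -/
noncomputable def edgeList : List DiagEdge := (finite_edgeSet T w).toFinset.toList

/-- The edges for the last state of the chain while reading `o`, with the state `i` of
the chain instead of `0`. -/
noncomputable def chainEdges (o : Option (Fin (2 ^ β))) (i : ℕ) : List DiagEdge :=
  ((edgeList T o.toList).filter fun e => e.1 = 13).map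
    fun e => (13 + i, shiftCode i e.2.1, e.2.2)

/-- An enumeration of the edges of the system. -/
noncomputable def edges : List DiagEdge :=
  (edgeList T []).filter (fun e => e.1 < 13) ++
    (List.range (w.length + 1)).flatMap fun i => chainEdges T w[i]? i

variable {T w}

theorem mem_edgeList {e : DiagEdge} : e ∈ edgeList T w ↔ e ∈ edgeSet T w := by
  simp [edgeList]

theorem isEncoding_edges : IsEncoding T w (edges T w) := by
  intro e
  simp only [edges, chainEdges, List.mem_append, List.mem_filter, List.mem_flatMap, List.mem_map,
    List.mem_range, mem_edgeList, decide_eq_true_eq]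
  constructor
  · rintro (⟨⟨p, r, a, b, x, y, h, -, rfl⟩, hlt⟩ |
      ⟨i, hi, e, ⟨⟨p, r, a, b, x, y, h, -, rfl⟩, hp⟩, rfl⟩)
    · exact ⟨p, r, a, b, x, y, h.of_code_lt hlt, Nat.lt_of_lt_of_le hlt (by omega), rfl⟩
    · obtain rfl : p = .chain 0 := St.code_injective hp
      obtain ⟨r', h', hr'⟩ := h.chain_global (by omega)
      refine ⟨.chain i, r', a, b, x, y, h', by simp only [St.code]; omega, ?_⟩
      rw [hr']
      rfl
  · rintro ⟨p, r, a, b, x, y, h, hp, rfl⟩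
    by_cases hlt : p.code < 13
    · exact .inl ⟨⟨p, r, a, b, x, y, h.of_code_lt hlt, Nat.lt_of_lt_of_le hlt (by omega), rfl⟩,
        hlt⟩
    · obtain ⟨i, rfl⟩ : ∃ i, p = .chain i := by
        cases p <;> first | exact ⟨_, rfl⟩ | simp [St.code] at hlt
      obtain ⟨r', h', hr'⟩ := h.chain_local
      simp only [St.code] at hp
      refine .inr ⟨i, by omega, _, ⟨⟨.chain 0, r', a, b, x, y, h', by simp only [St.code]; omega,
        rfl⟩, rfl⟩, ?_⟩
      rw [hr']
      rfl

theorem exists_mem_edges {p : ℕ} (hp : p < 14 + w.length) : ∃ e ∈ edges T w, e.1 = p := by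
  obtain ⟨p, rfl⟩ := St.exists_code_eq p
  obtain ⟨r, a, b, x, y, h⟩ := exists_step (T := T) hp
  exact ⟨_, (isEncoding_edges _).2 ⟨p, r, a, b, x, y, h, hp, rfl⟩, rfl⟩

theorem diagGifsWF_edges (hβ : 1 ≤ β) : DiagGifsWF (14 + w.length) (edges T w) 0 :=
  ⟨by omega, fun _ he => ⟨(isEncoding_edges.code_lt he).1, (isEncoding_edges.code_lt he).2,
    fun i => (isEncoding_edges.bounds hβ he i).1⟩, fun _ hp => exists_mem_edges hp⟩

theorem primrec_shiftCode : Primrec₂ shiftCode :=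
  Primrec.ite (Primrec.nat_lt.comp Primrec.snd (Primrec.const 13)) Primrec.snd
    (Primrec.nat_add.comp Primrec.snd Primrec.fst)

theorem primrec_chainEdges : Primrec₂ (chainEdges T) := by
  refine Primrec.list_map ((Primrec.dom_finite fun o : Option (Fin (2 ^ β)) =>
    (edgeList T o.toList).filter fun e => e.1 = 13).comp Primrec.fst) ?_
  exact ((Primrec.nat_add.comp (Primrec.const 13) (Primrec.snd.comp Primrec.fst)).pair
    ((primrec_shiftCode.comp (Primrec.snd.comp Primrec.fst)
      (Primrec.fst.comp (Primrec.snd.comp Primrec.snd))).pair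
    (Primrec.snd.comp (Primrec.snd.comp Primrec.snd))))

theorem primrec_edges : Primrec (edges T) := by
  refine Primrec.list_append.comp (Primrec.const _) (Primrec.list_flatMap
    (Primrec.list_range.comp (Primrec.succ.comp Primrec.list_length)) ?_)
  exact primrec_chainEdges.comp (Primrec.list_getElem?.comp Primrec.fst Primrec.snd) Primrec.snd

end Instances

end DiagGifs

namespace DiagGifs
open Turing StateTransition

theorem exists_enc (α : Type) [Finite α] [Nonempty α] : ∃ (β : ℕ) (enc : α → Fin (2 ^ β))
    (dec : Fin (2 ^ β) → α), 1 ≤ β ∧ Function.LeftInverse dec enc := by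
  obtain ⟨n, ⟨e⟩⟩ := Finite.exists_equiv_fin α
  have hn : n ≤ 2 ^ (n + 1) := (Nat.lt_succ_self n).le.trans Nat.lt_two_pow_self.le
  have hinj : Function.Injective fun a => Fin.castLE hn (e a) :=
    (Fin.castLE_injective hn).comp e.injective
  exact ⟨n + 1, _, _, by omega, Function.leftInverse_invFun hinj⟩

theorem primrec_inputWord {Γ Q : Type} [Inhabited Γ] [Inhabited Q] {β : ℕ}
    (enc : Letter Γ Q → Fin (2 ^ β)) {w : ℕ → List Γ} (hw : ∀ n, w n ≠ [])
    (hprim : ∀ g : Γ → Fin (2 ^ β), Primrec fun n => (w n).map g) :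
    Primrec fun n => inputWord enc (w n) := by
  have h (n : ℕ) : inputWord enc (w n) = enc .Y :: enc .Y ::
      (((w n).map fun a => enc (.cell (a, some default))).take 1 ++
        ((w n).map fun a => enc (.cell (a, none))).tail) := by
    have := hw n
    cases hwn : w n with
    | nil => exact absurd hwn this
    | cons a l => simp [inputWord]
  exact (Primrec.list_cons.comp (Primrec.const _) (Primrec.list_cons.comp (Primrec.const _)
    (Primrec.list_append.comp (Primrec.list_take.comp (Primrec.const 1) (hprim _))
      (Primrec.list_tail.comp (hprim _))))).of_eq fun n => (h n).symm

/-- The system for the input `l` has an attractor with empty interior if and only if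
the machine halts. -/
theorem forall_interior_eq_empty_iff {Γ Q : Type} [Inhabited Γ] [Inhabited Q]
    (M : TM0.Machine Γ Q) {β : ℕ} (hβ : 1 ≤ β) {enc : Letter Γ Q → Fin (2 ^ β)}
    {dec : Fin (2 ^ β) → Letter Γ Q} (hdec : Function.LeftInverse dec enc) {l : List Γ}
    (hl : l ≠ []) :
    (∀ X, IsDiagGifsAttractor (14 + (inputWord enc l).length)
      (edges (machineRules M hdec) (inputWord enc l)) X → interior (X 0) = ∅) ↔
      (eval (TM0.step M) (TM0.init l)).Dom := by
  have hL := isEncoding_edges (T := machineRules M hdec) (w := inputWord enc l)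
  rw [← exists_good_iff (M := M) (hdec := hdec) hl]
  constructor
  · intro h
    obtain ⟨X, hX⟩ := hL.exists_attractor hβ fun p hp => exists_mem_edges hp
    exact (hL.interior_eq_empty_iff hβ hX).1 (h X hX)
  · exact fun h X hX => (hL.interior_eq_empty_iff hβ hX).2 h

end DiagGifs

/-- It is undecidable whether the attractor component `X_q` of a 2-dimensional GIFS
whose maps are `f_e(x) = D_e x + v_e` with `v_e` rational and `D_e` diagonal with
diagonal entries negative powers of two (`2^{-m}`, `m ≥ 1`) has empty interior in `ℝ²`. -/
theorem undecidable_emptyInterior_diag_gifs :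
    ¬ ∃ f : ℕ × List DiagEdge × ℕ → Bool, Computable f ∧
      ∀ inst : ℕ × List DiagEdge × ℕ,
        DiagGifsWF inst.1 inst.2.1 inst.2.2 →
        (f inst = true ↔
          ∀ X : ℕ → Set (EuclideanSpace ℝ (Fin 2)),
            IsDiagGifsAttractor inst.1 inst.2.1 X →
            interior (X inst.2.2) = ∅) := by
  rintro ⟨f, hf, hdecides⟩
  obtain ⟨Γ, Q, _, _, _, _, M, w, hw, hprim, hM⟩ := DiagGifs.exists_undecidable_machine
  have : Nonempty (DiagGifs.Letter Γ Q) := ⟨.hash⟩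
  obtain ⟨β, enc, dec, hβ, hdec⟩ := DiagGifs.exists_enc (DiagGifs.Letter Γ Q)
  have hword := DiagGifs.primrec_inputWord enc hw fun g => hprim _ g
  refine hM (ComputablePred.computable_iff.2 ⟨fun n =>
    f (14 + (DiagGifs.inputWord enc (w n)).length,
    DiagGifs.edges (DiagGifs.machineRules M hdec) (DiagGifs.inputWord enc (w n)), 0), ?_, ?_⟩)
  · exact hf.comp ((Primrec.nat_add.comp (Primrec.const 14)
      (Primrec.list_length.comp hword)).pair
      ((DiagGifs.primrec_edges.comp hword).pair (Primrec.const 0))).to_comp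
  · funext n
    exact propext ((DiagGifs.forall_interior_eq_empty_iff M hβ hdec (hw n)).symm.trans
      (hdecides (_, _, _) (DiagGifs.diagGifsWF_edges hβ)).symm)
end

section
/- Let M be the 1-tape, 1-state automaton on alphabet {0,1} with three transitions labelled by the words 1, 10 and 00; that is, an infinite sequence c ∈ {0,1}^ℕ is accepted if and only if c is an infinite concatenation of words from {1, 10, 00}. Then c ∈ {0,1}^ℕ is accepted by M if and only if c does not begin with the word 0^{2k+1}1 for any k ≥ 0 (i.e., c does not start with an odd number of 0's immediately followed by a 1). -/
/-- `ConcatEq w s` : the infinite concatenation `w 0 ++ w 1 ++ ⋯` equals the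
infinite sequence `s`. -/
def ConcatEq {α : Type*} (w : ℕ → List α) (s : ℕ → α) : Prop :=
  ∀ (n : ℕ) (j : Fin (w n).length),
    s (((Finset.range n).sum fun i => (w i).length) + (j : ℕ)) = (w n).get j

/-- `c ∈ {0,1}^ℕ` is accepted by the 1-tape, 1-state automaton with transitions
labelled `1`, `10`, `00`: it is an infinite concatenation of words from `{1, 10, 00}`. -/
def Accepted01 (c : ℕ → Fin 2) : Prop :=
  ∃ w : ℕ → List (Fin 2),
    (∀ n, w n = [1] ∨ w n = [1, 0] ∨ w n = [0, 0]) ∧ ConcatEq w c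

/-- The sequence `c` has, from position `p` on, an odd number of zeros followed by a one. -/
def OddZerosThenOneAt (c : ℕ → Fin 2) (p : ℕ) : Prop :=
  ∃ k : ℕ, (∀ i < 2 * k + 1, c (p + i) = 0) ∧ c (p + (2 * k + 1)) = 1

theorem OddZerosThenOneAt.apply_eq_zero {c : ℕ → Fin 2} {p : ℕ} (h : OddZerosThenOneAt c p) :
    c p = 0 := by
  obtain ⟨k, h, -⟩ := h
  exact h 0 (by omega)

theorem OddZerosThenOneAt.not_succ {c : ℕ → Fin 2} {p : ℕ} (h : OddZerosThenOneAt c p) :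
    ¬ OddZerosThenOneAt c (p + 1) := by
  rintro ⟨l, hl, hl'⟩
  obtain ⟨k, hk, hk'⟩ := h
  rcases lt_or_ge k (l + 1) with hkl | hkl
  · have := hl (2 * k) (by omega)
    rw [show p + 1 + 2 * k = p + (2 * k + 1) by ring, hk'] at this
    exact one_ne_zero this
  · have := hk (2 * l + 2) (by omega)
    rw [show p + (2 * l + 2) = p + 1 + (2 * l + 1) by ring, hl'] at this
    exact one_ne_zero this

theorem OddZerosThenOneAt.of_add_two {c : ℕ → Fin 2} {p : ℕ} (h0 : c p = 0)
    (h1 : c (p + 1) = 0) (h : OddZerosThenOneAt c (p + 2)) : OddZerosThenOneAt c p := by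
  obtain ⟨k, hk, hk'⟩ := h
  refine ⟨k + 1, fun i hi => ?_, ?_⟩
  · rcases i with _ | _ | i
    · exact h0
    · exact h1
    · have := hk i (by omega)
      rwa [show p + 2 + i = p + (i + 1 + 1) by ring] at this
  · rwa [show p + 2 + (2 * k + 1) = p + (2 * (k + 1) + 1) by ring] at hk'

/-- A good position can be followed by one of the three words, leading to a good position. -/
theorem exists_word_of_not_oddZerosThenOneAt {c : ℕ → Fin 2} {p : ℕ}
    (h : ¬ OddZerosThenOneAt c p) :
    ∃ w : List (Fin 2), (w = [1] ∨ w = [1, 0] ∨ w = [0, 0]) ∧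
      (∀ j : Fin w.length, c (p + j) = w.get j) ∧ ¬ OddZerosThenOneAt c (p + w.length) := by
  rcases (by lia : c p = 0 ∨ c p = 1) with h0 | h0
  · have h1 : c (p + 1) = 0 := by
      by_contra h1
      refine h ⟨0, fun i hi => ?_, Fin.eq_one_of_ne_zero _ h1⟩
      obtain rfl : i = 0 := by omega
      exact h0
    refine ⟨[0, 0], by simp, ?_, fun h2 => h (.of_add_two h0 h1 h2)⟩
    intro j
    fin_cases j
    · exact h0
    · exact h1
  · by_cases h1 : OddZerosThenOneAt c (p + 1)
    · refine ⟨[1, 0], by simp, ?_, h1.not_succ⟩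
      intro j
      fin_cases j
      · exact h0
      · exact h1.apply_eq_zero
    · refine ⟨[1], by simp, ?_, h1⟩
      intro j
      fin_cases j
      exact h0

theorem accepted01_of_not_oddZerosThenOneAt {c : ℕ → Fin 2} (h : ¬ OddZerosThenOneAt c 0) :
    Accepted01 c := by
  choose w hw hget hgood using
    fun p : {p // ¬ OddZerosThenOneAt c p} => exists_word_of_not_oddZerosThenOneAt p.2
  let pos : ℕ → {p // ¬ OddZerosThenOneAt c p} :=
    fun n => Nat.rec ⟨0, h⟩ (fun _ p => ⟨p + (w p).length, hgood p⟩) n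
  have hpos : ∀ n, ((Finset.range n).sum fun i => (w (pos i)).length) = (pos n).1 := by
    intro n
    induction n with
    | zero => rfl
    | succ n ih => rw [Finset.sum_range_succ, ih]
  refine ⟨fun n => w (pos n), fun n => hw _, fun n j => ?_⟩
  rw [hpos]
  exact hget (pos n) j

theorem ConcatEq.eq_zero_zero_of_apply_eq_zero {c : ℕ → Fin 2} {w : ℕ → List (Fin 2)}
    (hw : ∀ n, w n = [1] ∨ w n = [1, 0] ∨ w n = [0, 0]) (h : ConcatEq w c) {n : ℕ}
    (h0 : c ((Finset.range n).sum fun i => (w i).length) = 0) : w n = [0, 0] := by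
  have key := h n
  rcases hw n with hn | hn | hn
  · rw [hn] at key
    exact absurd ((key ⟨0, by simp⟩).symm.trans h0) one_ne_zero
  · rw [hn] at key
    exact absurd ((key ⟨0, by simp⟩).symm.trans h0) one_ne_zero
  · exact hn

theorem Accepted01.not_oddZerosThenOneAt {c : ℕ → Fin 2} (h : Accepted01 c) :
    ¬ OddZerosThenOneAt c 0 := by
  rintro ⟨k, hk, hk'⟩
  simp only [zero_add] at hk hk'
  obtain ⟨w, hw, h⟩ := h
  have hsum : ∀ n ≤ k, ((Finset.range n).sum fun i => (w i).length) = 2 * n := by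
    intro n hn
    induction n with
    | zero => rfl
    | succ n ih =>
      have ih := ih (by omega)
      have hwn := h.eq_zero_zero_of_apply_eq_zero hw (n := n) (by rw [ih]; exact hk _ (by omega))
      rw [Finset.sum_range_succ, ih, hwn]
      rfl
  have hwk := h.eq_zero_zero_of_apply_eq_zero hw (n := k)
    (by rw [hsum k le_rfl]; exact hk _ (by omega))
  have key := h k
  rw [hsum k le_rfl, hwk] at key
  exact one_ne_zero (hk'.symm.trans (key ⟨1, by simp⟩))

/-- A sequence is accepted by the automaton with transitions `1`, `10`, `00` if and
only if it does not begin with `0^{2k+1} 1` for any `k ≥ 0`. -/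
theorem accepted01_iff_not_odd_zeros_then_one (c : ℕ → Fin 2) :
    Accepted01 c ↔
      ¬ ∃ k : ℕ, (∀ i < 2 * k + 1, c i = 0) ∧ c (2 * k + 1) = 1 := by
  have hiff : OddZerosThenOneAt c 0 ↔
      ∃ k : ℕ, (∀ i < 2 * k + 1, c i = 0) ∧ c (2 * k + 1) = 1 := by
    simp only [OddZerosThenOneAt, zero_add]
  rw [← hiff]
  exact ⟨Accepted01.not_oddZerosThenOneAt, accepted01_of_not_oddZerosThenOneAt⟩
end

section
/- Let X = {Σ_{i≥1} c_i 2^{−i} : c ∈ {0,1}^ℕ is an infinite concatenation of words from {1, 10, 00}}. Then X = {0} ∪ ⋃_{k≥0} [2^{−2k−1}, 2^{−2k}]. In particular X has nonempty interior in ℝ but X ≠ [0,1]. -/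
/-- `X = { Σ_{i ≥ 1} c_i 2^{-i} : c an infinite concatenation of words from {1,10,00} }`. -/
noncomputable def X01 : Set ℝ :=
  {x | ∃ c : ℕ → Fin 2, Accepted01 c ∧ x = ∑' i : ℕ, ((c i : ℕ) : ℝ) / 2 ^ (i + 1)}

open Finset in
/-- Coinduction principle: if at every admissible position `p` of `s` a word from `W` can be read
that ends at an admissible position, then `s` is a concatenation of words from `W`. -/
theorem exists_concatEq_of_forall_exists {α : Type*} {W : Set (List α)} {s : ℕ → α}
    (Q : ℕ → Prop) (h0 : Q 0)
    (hQ : ∀ p, Q p → ∃ u ∈ W, (∀ j : Fin u.length, s (p + j) = u.get j) ∧ Q (p + u.length)) :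
    ∃ w : ℕ → List α, (∀ n, w n ∈ W) ∧ ConcatEq w s := by
  choose f hfW hfs hfQ using hQ
  let pos : ℕ → {p // Q p} := fun n =>
    Nat.rec ⟨0, h0⟩ (fun _ p => ⟨p.1 + (f p.1 p.2).length, hfQ p.1 p.2⟩) n
  have hpos : ∀ n, ∑ i ∈ range n, (f (pos i).1 (pos i).2).length = (pos n).1 := by
    intro n
    induction n with
    | zero => rfl
    | succ n ih => rw [sum_range_succ, ih]
  refine ⟨fun n => f (pos n).1 (pos n).2, fun n => hfW _ _, fun n j => ?_⟩
  rw [hpos n]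
  exact hfs _ _ j

/-- A binary sequence is a concatenation of words from `{1, 10, 00}` if and only if its first `1`,
if there is any, is preceded by an even number of zeros. -/
theorem accepted01_iff (c : ℕ → Fin 2) :
    Accepted01 c ↔ ∀ m, c m = 1 → (∀ i < m, c i = 0) → Even m := by
  have ne_one : ∀ a : Fin 2, a ≠ 1 → a = 0 := by decide
  constructor
  · rintro ⟨w, hw, hc⟩ m hm hz
    have first_eq_zero : ∀ n, ∑ i ∈ Finset.range n, (w i).length < m →
        w n = [0, 0] := by
      intro n hn
      have h := hc n
      have h0 := hz _ hn
      rcases hw n with hwn | hwn | hwn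
      · rw [hwn] at h
        have := h ⟨0, by simp⟩
        simp [h0] at this
      · rw [hwn] at h
        have := h ⟨0, by simp⟩
        simp [h0] at this
      · exact hwn
    have hlen : ∀ n, 2 * n ≤ m + 1 → ∑ i ∈ Finset.range n, (w i).length = 2 * n := by
      intro n
      induction n with
      | zero => simp
      | succ n ih =>
        intro hn
        have hs := ih (by omega)
        rw [Finset.sum_range_succ, hs, first_eq_zero n (by omega)]
        simp
        ring
    by_contra hodd
    obtain ⟨k, rfl⟩ := Nat.not_even_iff_odd.1 hodd
    have hs := hlen k (by omega)
    have hwk := first_eq_zero k (by omega)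
    have h := hc k
    rw [hwk, hs] at h
    have := h ⟨1, by simp⟩
    simp [hm] at this
  · intro h
    suffices ∃ w : ℕ → List (Fin 2), (∀ n, w n ∈ ({[1], [1, 0], [0, 0]} : Set _)) ∧
        ConcatEq w c by simpa [Accepted01] using this
    refine exists_concatEq_of_forall_exists
      (fun p => ∀ m, c (p + m) = 1 → (∀ i < m, c (p + i) = 0) → Even m) (by simpa using h) ?_
    intro p hp
    by_cases h1 : c p = 1
    · by_cases hnext : ∀ m, c (p + 1 + m) = 1 → (∀ i < m, c (p + 1 + i) = 0) → Even m
      · exact ⟨[1], by simp, by simpa [Fin.forall_fin_one] using h1, hnext⟩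
      · push Not at hnext
        obtain ⟨m, hm, hz, hodd⟩ := hnext
        obtain ⟨k, rfl⟩ := Nat.not_even_iff_odd.1 hodd
        have h2 : c (p + 1) = 0 := hz 0 (by omega)
        refine ⟨[1, 0], by simp, by simp [Fin.forall_fin_two, h1, h2], ?_⟩
        intro m' hm' hz'
        simp only [List.length_cons, List.length_nil, zero_add, Nat.reduceAdd] at hm' hz'
        suffices m' = 2 * k by simp [this]
        rcases lt_trichotomy m' (2 * k) with hlt | heq | hgt
        · have := hz (m' + 1) (by omega)
          rw [show p + 1 + (m' + 1) = p + 2 + m' by ring, hm'] at this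
          simp at this
        · exact heq
        · have := hz' (2 * k) hgt
          rw [show p + 2 + 2 * k = p + 1 + (2 * k + 1) by ring, hm] at this
          simp at this
    · have h0 : c p = 0 := ne_one _ h1
      have h2 : c (p + 1) = 0 := by
        refine ne_one _ fun h2 => ?_
        have := hp 1 h2 (by simpa using h0)
        simp at this
      refine ⟨[0, 0], by simp, by simp [Fin.forall_fin_two, h0, h2], ?_⟩
      intro m hm hz
      simp only [List.length_cons, List.length_nil, zero_add, Nat.reduceAdd] at hm hz
      have := hp (m + 2) (by rwa [show p + (m + 2) = p + 2 + m by ring]) fun i hi => by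
        rcases i with _ | _ | i
        · exact h0
        · exact h2
        · rw [show p + (i + 1 + 1) = p + 2 + i by ring]
          exact hz i (by omega)
      simpa [Nat.even_add] using this

theorem mem_X01_iff (x : ℝ) : x ∈ X01 ↔ ∃ c, Accepted01 c ∧ x = Real.ofDigits c := by
  simp only [X01, Set.mem_ofPred_eq, Real.ofDigits, Real.ofDigitsTerm, div_eq_mul_inv,
    Nat.cast_ofNat]

/-- The value of a binary expansion whose first `1` is in position `m`. -/
theorem Real.ofDigits_eq_of_first_one {c : ℕ → Fin 2} {m : ℕ} (hm : c m = 1)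
    (hz : ∀ i < m, c i = 0) :
    Real.ofDigits c = (1 + Real.ofDigits fun i => c (i + (m + 1))) / 2 ^ (m + 1) := by
  rw [Real.ofDigits_eq_sum_add_ofDigits c (m + 1), Finset.sum_range_succ,
    Finset.sum_eq_zero fun i hi => by simp [Real.ofDigitsTerm, hz i (Finset.mem_range.1 hi)]]
  simp [Real.ofDigitsTerm, hm]
  ring

theorem X01_eq :
    X01 = {0} ∪ ⋃ k : ℕ, Set.Icc ((1 : ℝ) / 2 ^ (2 * k + 1)) ((1 : ℝ) / 2 ^ (2 * k)) := by
  ext x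
  rw [mem_X01_iff]
  simp only [accepted01_iff, Set.mem_union, Set.mem_singleton_iff, Set.mem_iUnion, Set.mem_Icc]
  constructor
  · rintro ⟨c, hc, rfl⟩
    by_cases h : ∃ m, c m = 1
    · right
      have hz : ∀ i < Nat.find h, c i = 0 := fun i hi => by
        have := Nat.find_min h hi
        omega
      obtain ⟨k, hk⟩ := even_iff_two_dvd.1 (hc _ (Nat.find_spec h) hz)
      have hm := Nat.find_spec h
      rw [hk] at hm hz
      rw [Real.ofDigits_eq_of_first_one hm hz]
      have h0 := Real.ofDigits_nonneg fun i => c (i + (2 * k + 1))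
      have h1 := Real.ofDigits_le_one fun i => c (i + (2 * k + 1))
      refine ⟨k, by gcongr; linarith, ?_⟩
      rw [pow_succ, div_le_div_iff₀ (by positivity) (by positivity)]
      nlinarith [show (0 : ℝ) < 2 ^ (2 * k) by positivity]
    · left
      push Not at h
      have : ∀ i, c i = 0 := fun i => by
        have := h i
        omega
      simp [Real.ofDigits, Real.ofDigitsTerm, this]
  · rintro (rfl | ⟨k, hk, hk'⟩)
    · exact ⟨0, by simp, by simp [Real.ofDigits, Real.ofDigitsTerm]⟩
    · have hpos : (0 : ℝ) < 2 ^ (2 * k + 1) := by positivity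
      rw [div_le_iff₀ hpos] at hk
      rw [le_div_iff₀ (by positivity)] at hk'
      obtain ⟨d, -, hd⟩ := Real.ofDigits_SurjOn one_lt_two
        (show x * 2 ^ (2 * k + 1) - 1 ∈ Set.Icc (0 : ℝ) 1 from
          ⟨by linarith, by rw [pow_succ]; linarith⟩)
      let c : ℕ → Fin 2 := fun i =>
        if i < 2 * k then 0 else if i = 2 * k then 1 else d (i - (2 * k + 1))
      have hm : c (2 * k) = 1 := by simp [c]
      have hz : ∀ i < 2 * k, c i = 0 := fun i hi => by simp [c, hi]
      have htail : (fun i => c (i + (2 * k + 1))) = d := by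
        funext i
        simp only [c]
        rw [if_neg (by omega), if_neg (by omega), Nat.add_sub_cancel]
      refine ⟨c, fun m hcm hzm => ?_, ?_⟩
      · rcases lt_trichotomy m (2 * k) with hlt | rfl | hgt
        · simp [hz m hlt] at hcm
        · simp
        · simp [hzm _ hgt] at hm
      · rw [Real.ofDigits_eq_of_first_one hm hz, htail, hd]
        field_simp
        ring

/-- `X = {0} ∪ ⋃_{k ≥ 0} [2^{-2k-1}, 2^{-2k}]`; in particular `X` has nonempty
interior in `ℝ` but `X ≠ [0,1]`. -/
theorem X01_eq_union_Icc :
    (X01 = {0} ∪ ⋃ k : ℕ, Set.Icc ((1 : ℝ) / 2 ^ (2 * k + 1)) ((1 : ℝ) / 2 ^ (2 * k))) ∧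
    (interior X01).Nonempty ∧ X01 ≠ Set.Icc (0 : ℝ) 1 := by
  refine ⟨X01_eq, ?_, ?_⟩
  · have hsub : Set.Icc (1 / 2 : ℝ) 1 ⊆ X01 := by
      rw [X01_eq]
      refine fun x hx => Or.inr (Set.mem_iUnion.2 ⟨0, ?_⟩)
      simpa using hx
    refine ⟨3 / 4, interior_mono hsub ?_⟩
    rw [interior_Icc]
    norm_num
  · intro h
    have hmem : (3 / 8 : ℝ) ∈ X01 := by
      rw [h]
      norm_num
    rw [X01_eq] at hmem
    rcases hmem with h0 | hmem
    · norm_num at h0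
    · obtain ⟨k, hk, hk'⟩ := Set.mem_iUnion.1 hmem
      rcases k with _ | k
      · norm_num at hk
      · rw [show 2 * (k + 1) = 2 * k + 2 by ring, pow_add,
          le_div_iff₀ (by positivity)] at hk'
        have : (1 : ℝ) ≤ 2 ^ (2 * k) := one_le_pow₀ one_le_two
        linarith
end

section
/- For the 1-tape, 1-state automaton on alphabet {0,1} with three transitions labelled by the words 1, 10 and 00 (a sequence being accepted iff it is an infinite concatenation of words from {1, 10, 00}): the single state is not universal (the sequence 01 0^ω is not accepted), but the one-letter word 1 is a universal prefix (every sequence beginning with 1 is accepted). -/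
/-- To split `s` into words satisfying `W`, it suffices to find an invariant `P` of positions,
true at `0`, that allows one to read a word and preserve the invariant. -/
theorem exists_concatEq_of_invariant {α : Type*} {W : List α → Prop} {P : ℕ → Prop} {s : ℕ → α}
    (zero : P 0)
    (step : ∀ p, P p → ∃ w : List α, W w ∧
      (∀ j : Fin w.length, s (p + (j : ℕ)) = w.get j) ∧ P (p + w.length)) :
    ∃ w : ℕ → List α, (∀ n, W (w n)) ∧ ConcatEq w s := by
  have step' : ∀ p, ∃ w : List α, P p → W w ∧
      (∀ j : Fin w.length, s (p + (j : ℕ)) = w.get j) ∧ P (p + w.length) := by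
    intro p
    by_cases hp : P p
    · obtain ⟨w, hw⟩ := step p hp
      exact ⟨w, fun _ => hw⟩
    · exact ⟨[], fun h => absurd h hp⟩
  choose f hf using step'
  let pos : ℕ → ℕ := fun n => (fun p => p + (f p).length)^[n] 0
  have pos_succ : ∀ n, pos (n + 1) = pos n + (f (pos n)).length := fun n =>
    Function.iterate_succ_apply' _ _ _
  have hpos : ∀ n, P (pos n) := by
    intro n
    induction n with
    | zero => exact zero
    | succ n ih => rw [pos_succ]; exact (hf _ ih).2.2
  have hsum : ∀ n, (∑ i ∈ Finset.range n, (f (pos i)).length) = pos n := by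
    intro n
    induction n with
    | zero => rfl
    | succ n ih => rw [Finset.sum_range_succ, ih, pos_succ]
  refine ⟨fun n => f (pos n), fun n => (hf _ (hpos n)).1, fun n j => ?_⟩
  rw [hsum]
  exact (hf _ (hpos n)).2.1 j

/-- The maximal run of zeros of `c` starting at position `p` is infinite or of even length. -/
def EvenZeroRun (c : ℕ → Fin 2) (p : ℕ) : Prop :=
  ∀ k, (∀ i < k, c (p + i) = 0) → c (p + k) = 1 → Even k

theorem evenZeroRun_of_eq_one {c : ℕ → Fin 2} {p : ℕ} (h : c p = 1) : EvenZeroRun c p := by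
  intro k hk _
  rcases Nat.eq_zero_or_pos k with rfl | hpos
  · exact Even.zero
  · have := hk 0 hpos
    simp [h] at this

theorem EvenZeroRun.add_two {c : ℕ → Fin 2} {p : ℕ} (h : EvenZeroRun c p)
    (h₀ : c p = 0) (h₁ : c (p + 1) = 0) : EvenZeroRun c (p + 2) := by
  intro k hk hk1
  have : Even (k + 2) := by
    refine h (k + 2) (fun i hi => ?_) (by rw [← hk1]; congr 1; omega)
    match i, hi with
    | 0, _ => exact h₀
    | 1, _ => exact h₁
    | i + 2, hi => rw [← hk i (by omega)]; congr 1; omega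
  simpa [Nat.even_add] using this

/-- Removing the first zero of a run of odd length leaves a run of even length. -/
theorem evenZeroRun_succ_of_not {c : ℕ → Fin 2} {p : ℕ} (h : ¬ EvenZeroRun c p) :
    c p = 0 ∧ EvenZeroRun c (p + 1) := by
  simp only [EvenZeroRun, not_forall] at h
  obtain ⟨k, hk, hk1, hodd⟩ := h
  have hkpos : 0 < k := Nat.pos_of_ne_zero (by rintro rfl; exact hodd Even.zero)
  refine ⟨hk 0 hkpos, fun l hl hl1 => ?_⟩
  have hlk : l + 1 = k := by
    rcases lt_trichotomy (l + 1) k with hlt | heq | hgt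
    · have := hk (l + 1) hlt
      rw [show p + (l + 1) = p + 1 + l by omega, hl1] at this
      exact absurd this (by decide)
    · exact heq
    · have := hl (k - 1) (by omega)
      rw [show p + 1 + (k - 1) = p + k by omega, hk1] at this
      exact absurd this (by decide)
  rw [← hlk, Nat.even_add_one, not_not] at hodd
  exact hodd

theorem EvenZeroRun.exists_word {c : ℕ → Fin 2} {p : ℕ} (h : EvenZeroRun c p) :
    ∃ w : List (Fin 2), (w = [1] ∨ w = [1, 0] ∨ w = [0, 0]) ∧
      (∀ j : Fin w.length, c (p + (j : ℕ)) = w.get j) ∧ EvenZeroRun c (p + w.length) := by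
  have two : ∀ x : Fin 2, x = 0 ∨ x = 1 := by decide
  rcases two (c p) with h₀ | h₁
  · have h₁ : c (p + 1) = 0 := by
      refine (two _).resolve_right fun h₁ => ?_
      have := h 1 (fun i hi => by simpa [Nat.lt_one_iff.mp hi] using h₀) h₁
      exact absurd this (by decide)
    exact ⟨[0, 0], by simp, by simp [Fin.forall_fin_two, h₀, h₁], h.add_two h₀ h₁⟩
  · by_cases hp : EvenZeroRun c (p + 1)
    · exact ⟨[1], by simp, by simp [h₁], hp⟩
    · obtain ⟨h₂, h₃⟩ := evenZeroRun_succ_of_not hp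
      exact ⟨[1, 0], by simp, by simp [Fin.forall_fin_two, h₁, h₂], h₃⟩

/-- The single state of the automaton with transitions `1`, `10`, `00` is not universal
(the sequence `01 0^ω` is not accepted), but the word `1` is a universal prefix
(every sequence beginning with `1` is accepted). -/
theorem automaton01_not_universal_but_universal_prefix :
    ¬ Accepted01 (fun i => if i = 1 then 1 else 0) ∧
    (∀ c : ℕ → Fin 2, c 0 = 1 → Accepted01 c) := by
  refine ⟨?_, fun c hc => exists_concatEq_of_invariant (evenZeroRun_of_eq_one hc)
    fun p hp => hp.exists_word⟩
  rintro ⟨w, hw, hc⟩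
  have h := hc 0
  rcases hw 0 with h₀ | h₀ | h₀ <;> rw [h₀] at h <;> simp [Fin.forall_fin_two] at h
end
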